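/- For every real η > 0 there exists a positive integer k = k_η such that the pair (k; 1/2 + η) is admissible: for every ε > 0 there exists M such that for every integer m ≥ M and every integer a with gcd(a,m) = 1, the class a modulo m is represented by a product of at most k primes, each at most m^{1/2 + η + ε}. -/

import Mathlib

open Finset Pointwise in
lemma growth_aux {G : Type*} [CommGroup G] [Fintype G] [DecidableEq G] (B : Finset G)
    (h1 : (1 : G) ∈ B) (hgen : Subgroup.closure (B : Set G) = ⊤) (i : ℕ) :
    B ^ (2 ^ i) = univ ∨ (3 / 2 : ℚ) ^ i * #B ≤ #(B ^ (2 ^ i)) := by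
  induction i with
  | zero => right; simp
  | succ i ih =>
    have hX1 : (1 : G) ∈ B ^ (2 ^ i) := one_mem_pow h1
    have hsub : B ⊆ B ^ (2 ^ i) := by
      have := pow_subset_pow_right h1 (Nat.one_le_two_pow (n := i))
      simpa using this
    have hXX : B ^ (2 ^ (i + 1)) = B ^ (2 ^ i) * B ^ (2 ^ i) := by
      rw [← pow_add]; congr 1; ring
    rw [hXX]
    generalize B ^ (2 ^ i) = X at *
    by_cases h : (#(X * X) : ℚ) < (3 / 2 : ℚ) * #X
    · left
      have h2 := smul_inv_mul_opSMul_eq_mul_of_doubling_lt_three_halves h hX1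
      simp only [MulOpposite.op_one, one_smul] at h2
      have h3 := invMulSubgroup_eq_inv_mul X h
      have h4 : Subgroup.closure (B : Set G) ≤ invMulSubgroup X h := by
        rw [Subgroup.closure_le, h3]
        intro b hb
        rw [← coe_mul, h2]
        exact mem_coe.2 (mem_mul.2 ⟨1, hX1, b, hsub hb, one_mul b⟩)
      rw [hgen] at h4
      ext g
      have : g ∈ invMulSubgroup X h := h4 (Subgroup.mem_top g)
      rw [← SetLike.mem_coe, h3, ← coe_mul, h2] at this
      exact iff_of_true (mem_coe.1 this) (mem_univ g)
    · push Not at h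
      rcases ih with ih | ih
      · left; rw [ih]; ext g; simp
      · right
        calc _ = (3/2 : ℚ) * ((3 / 2) ^ i * #B) := by ring
          _ ≤ (3/2) * #X := by gcongr
          _ ≤ _ := h

open Finset Pointwise in
lemma growth {G : Type*} [CommGroup G] [Fintype G] [DecidableEq G] (B : Finset G)
    (h1 : (1 : G) ∈ B) (hgen : Subgroup.closure (B : Set G) = ⊤) (i : ℕ)
    (hc : (Fintype.card G : ℚ) < (3 / 2 : ℚ) ^ i * #B) :
    B ^ (2 ^ i) = univ := by
  rcases growth_aux B h1 hgen i with h | h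
  · exact h
  · have := hc.trans_le h
    norm_cast at this
    exact absurd this (not_lt.2 (card_le_univ _))

open Finset in
lemma zmod_parseval {N : ℕ} [NeZero N] (f : ZMod N → ℂ) :
    ∑ h : ZMod N, ‖∑ n, f n * ZMod.stdAddChar (h * n)‖ ^ 2 = N * ∑ n, ‖f n‖ ^ 2 := by
  have key : ((∑ h : ZMod N, ‖∑ n, f n * ZMod.stdAddChar (h * n)‖ ^ 2 : ℝ) : ℂ)
      = ((N * ∑ n, ‖f n‖ ^ 2 : ℝ) : ℂ) := by
    push_cast
    have h1 : ∀ z : ℂ, (‖z‖ : ℂ) ^ 2 = z * (starRingEnd ℂ) z := fun z => by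
      rw [Complex.mul_conj, Complex.normSq_eq_norm_sq]; push_cast; rfl
    have h2 : ∀ x : ZMod N, (starRingEnd ℂ) (ZMod.stdAddChar (N := N) x) = ZMod.stdAddChar (-x) :=
      fun x => (AddChar.map_neg_eq_conj _ x).symm
    simp_rw [h1, map_sum, map_mul, h2, sum_mul_sum]
    rw [sum_comm]
    have h3 : ∀ x y h : ZMod N, f x * ZMod.stdAddChar (h * x) *
        ((starRingEnd ℂ) (f y) * ZMod.stdAddChar (-(h * y)))
        = (f x * (starRingEnd ℂ) (f y)) * ZMod.stdAddChar (h * (x - y)) := by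
      intro x y h
      have : h * (x - y) = h * x + -(h * y) := by ring
      rw [this, AddChar.map_add_eq_mul]; ring
    simp_rw [h3]
    have : ∀ x : ZMod N, ∑ h : ZMod N, ∑ y : ZMod N,
        (f x * (starRingEnd ℂ) (f y)) * ZMod.stdAddChar (h * (x - y))
        = N * (f x * (starRingEnd ℂ) (f x)) := by
      intro x
      rw [sum_comm]
      simp_rw [← mul_sum, AddChar.sum_mulShift _ (ZMod.isPrimitive_stdAddChar N), sub_eq_zero]
      simp [ZMod.card, mul_comm]
    simp_rw [this, mul_sum]
  exact_mod_cast key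

open Finset in
lemma prim_gauss_le {N : ℕ} [NeZero N] (χ : DirichletCharacter ℂ N) (hχ : χ.IsPrimitive) :
    ‖gaussSum χ ZMod.stdAddChar‖ ^ 2 ≤ N := by
  have hp := zmod_parseval (N := N) (fun n => χ n)
  have h1 : ∀ h : ZMod N, ∑ n, χ n * ZMod.stdAddChar (h * n)
      = χ⁻¹ h * gaussSum χ ZMod.stdAddChar := by
    intro h
    rw [← gaussSum_mulShift_of_isPrimitive _ hχ]
    rfl
  simp_rw [h1, norm_mul, mul_pow] at hp
  rw [← sum_mul] at hp
  have h2 : ∀ h : ZMod N, ‖χ⁻¹ h‖ = ‖χ h‖ := by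
    intro h
    by_cases hu : IsUnit h
    · obtain ⟨u, rfl⟩ := hu
      rw [DirichletCharacter.unit_norm_eq_one, DirichletCharacter.unit_norm_eq_one]
    · rw [MulChar.map_nonunit _ hu, MulChar.map_nonunit _ hu]
  simp_rw [h2] at hp
  have h3 : 0 < ∑ h : ZMod N, ‖χ h‖ ^ 2 := by
    refine lt_of_lt_of_le ?_ (single_le_sum (f := fun h => ‖χ h‖ ^ 2)
      (fun i _ => by positivity) (mem_univ (1 : ZMod N)))
    simp
  nlinarith

open Finset in
lemma prim_bilinear {N : ℕ} [NeZero N] (χ : DirichletCharacter ℂ N) (hχ : χ.IsPrimitive)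
    (A B : Finset (ZMod N)) :
    ‖∑ a ∈ A, ∑ b ∈ B, χ (a + b)‖ ^ 2 ≤ N * (#A * #B) := by
  set τ := gaussSum χ ZMod.stdAddChar with hτ
  have hτN := prim_gauss_le χ hχ
  let F : Finset (ZMod N) → ZMod N → ℂ := fun A h =>
    ∑ n, (if n ∈ A then (1 : ℂ) else 0) * ZMod.stdAddChar (h * n)
  have hF : ∀ A : Finset (ZMod N), ∑ h, ‖F A h‖ ^ 2 = N * #A := by
    intro A
    have := zmod_parseval (N := N) (fun n => if n ∈ A then (1 : ℂ) else 0)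
    rw [this]
    congr 1
    simp [apply_ite, ite_pow]
  have hF2 : ∀ (A : Finset (ZMod N)) h, F A h = ∑ n ∈ A, ZMod.stdAddChar (h * n) := by
    intro A h; simp [F, ite_mul]
  have h1 : ∀ h : ZMod N, ∑ n, χ n * ZMod.stdAddChar (h * n) = χ⁻¹ h * τ := by
    intro h
    rw [hτ, ← gaussSum_mulShift_of_isPrimitive _ hχ]
    rfl
  have hT : ∑ h : ZMod N, (χ⁻¹ (-h) * τ) * (F A h * F B h)
      = N * ∑ a ∈ A, ∑ b ∈ B, χ (a + b) := by
    have e : ∀ h : ZMod N, (χ⁻¹ (-h) * τ) * (F A h * F B h) =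
        ∑ a ∈ A, ∑ b ∈ B, ∑ n, χ n * ZMod.stdAddChar (h * (a + b - n)) := by
      intro h
      rw [← h1, hF2, hF2, sum_mul_sum, mul_sum]
      refine sum_congr rfl fun a _ => ?_
      rw [mul_sum]
      refine sum_congr rfl fun b _ => ?_
      rw [sum_mul]
      refine sum_congr rfl fun n _ => ?_
      have : h * (a + b - n) = -h * n + (h * a + h * b) := by ring
      rw [this, AddChar.map_add_eq_mul, AddChar.map_add_eq_mul]
      ring
    simp_rw [e]
    rw [sum_comm, mul_sum]
    refine sum_congr rfl fun a _ => ?_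
    rw [sum_comm, mul_sum]
    refine sum_congr rfl fun b _ => ?_
    rw [sum_comm]
    simp_rw [← mul_sum, AddChar.sum_mulShift _ (ZMod.isPrimitive_stdAddChar N), sub_eq_zero]
    simp [ZMod.card, mul_comm]
  have hN : (0 : ℝ) < N := by exact_mod_cast Nat.pos_of_ne_zero (NeZero.ne N)
  have hle : (N : ℝ) * ‖∑ a ∈ A, ∑ b ∈ B, χ (a + b)‖ ≤ ‖τ‖ * ∑ h, ‖F A h‖ * ‖F B h‖ := by
    have : (N : ℝ) * ‖∑ a ∈ A, ∑ b ∈ B, χ (a + b)‖ =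
        ‖(N : ℂ) * ∑ a ∈ A, ∑ b ∈ B, χ (a + b)‖ := by simp
    rw [this, ← hT, mul_sum]
    refine (norm_sum_le _ _).trans (sum_le_sum fun h _ => ?_)
    rw [norm_mul, norm_mul, norm_mul]
    have : ‖χ⁻¹ (-h)‖ ≤ 1 := DirichletCharacter.norm_le_one _ _
    have h0 : 0 ≤ ‖τ‖ * (‖F A h‖ * ‖F B h‖) := by positivity
    nlinarith
  have hcs : (∑ h, ‖F A h‖ * ‖F B h‖) ^ 2 ≤ (N * #A) * (N * #B) := by
    rw [← hF, ← hF]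
    exact sum_mul_sq_le_sq_mul_sq _ _ _
  have h4 : ((N : ℝ) * ‖∑ a ∈ A, ∑ b ∈ B, χ (a + b)‖) ^ 2 ≤
      N * ((N * #A) * (N * #B)) := by
    calc _ ≤ (‖τ‖ * ∑ h, ‖F A h‖ * ‖F B h‖) ^ 2 := by gcongr
      _ = ‖τ‖ ^ 2 * (∑ h, ‖F A h‖ * ‖F B h‖) ^ 2 := by ring
      _ ≤ _ := by gcongr
  have h5 : (N : ℝ) ^ 2 * ‖∑ a ∈ A, ∑ b ∈ B, χ (a + b)‖ ^ 2 ≤ N ^ 2 * (N * (#A * #B)) := by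
    linarith [h4]
  exact le_of_mul_le_mul_left h5 (by positivity)

open Finset in
lemma sum_range_period {N : ℕ} [NeZero N] (f : ZMod N → ℂ) (hf : ∑ x, f x = 0) (l : ℕ) :
    ∑ i ∈ range l, f i = ∑ i ∈ range (l % N), f i := by
  have h0 : ∑ i ∈ range N, f i = 0 := by
    rw [← hf]
    refine sum_bij (fun i _ => (i : ZMod N)) (fun _ _ => mem_univ _) ?_ ?_ (fun _ _ => rfl)
    · intro a ha b hb hab
      rw [mem_range] at ha hb
      rwa [ZMod.natCast_eq_natCast_iff', Nat.mod_eq_of_lt ha, Nat.mod_eq_of_lt hb] at hab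
    · intro b _
      exact ⟨b.val, mem_range.2 (ZMod.val_lt b), by simp⟩
  have h1 : ∀ k r : ℕ, ∑ i ∈ range (N * k + r), f i = ∑ i ∈ range r, f i := by
    intro k
    induction k with
    | zero => intro r; simp
    | succ k ih =>
      intro r
      have : N * (k + 1) + r = N + (N * k + r) := by ring
      rw [this, sum_range_add, h0, zero_add, ← ih r]
      refine sum_congr rfl fun i _ => ?_
      simp
  conv_lhs => rw [← Nat.div_add_mod l N]
  exact h1 _ _

open Finset in
lemma prim_bilinear_int {N : ℕ} [NeZero N] (χ : DirichletCharacter ℂ N) (hχ : χ.IsPrimitive)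
    (h1 : χ ≠ 1) (k l : ℕ) :
    ‖∑ a ∈ range k, ∑ b ∈ range l, χ (a + b + 1 : ℕ)‖ ^ 2 ≤ N * (k * l) := by
  have hs : ∀ c : ZMod N, ∑ x : ZMod N, χ (c + x) = 0 := by
    intro c
    rw [← MulChar.sum_eq_zero_of_ne_one h1]
    exact Fintype.sum_equiv (Equiv.addLeft c) _ _ (fun _ => rfl)
  have e1 : ∑ a ∈ range k, ∑ b ∈ range l, χ (a + b + 1 : ℕ)
      = ∑ a ∈ range (k % N), ∑ b ∈ range (l % N), χ (a + b + 1 : ℕ) := by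
    have e2 : ∀ a : ℕ, ∑ b ∈ range l, χ (a + b + 1 : ℕ) = ∑ b ∈ range (l % N), χ (a + b + 1 : ℕ) := by
      intro a
      have := sum_range_period (fun x => χ ((a + 1 : ZMod N) + x)) (hs _) l
      convert this using 3 <;> push_cast <;> ring
    simp_rw [e2]
    rw [sum_comm, sum_comm (s := range (k % N))]
    refine sum_congr rfl fun b _ => ?_
    have := sum_range_period (fun x => χ ((b + 1 : ZMod N) + x)) (hs _) k
    convert this using 3 <;> push_cast <;> ring
  have inj : ∀ (s : ZMod N) (k : ℕ), Set.InjOn (fun i : ℕ => (i : ZMod N) + s) (range (k % N)) := by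
    intro s k a ha b hb hab
    have hN := Nat.pos_of_ne_zero (NeZero.ne N)
    have ha' : a < N := (mem_range.1 (mem_coe.1 ha)).trans (Nat.mod_lt _ hN)
    have hb' : b < N := (mem_range.1 (mem_coe.1 hb)).trans (Nat.mod_lt _ hN)
    have hab : (a : ZMod N) = b := by simpa using hab
    rwa [ZMod.natCast_eq_natCast_iff', Nat.mod_eq_of_lt ha', Nat.mod_eq_of_lt hb'] at hab
  have := prim_bilinear χ hχ ((range (k % N)).image (fun i : ℕ => (i : ZMod N) + 0))
    ((range (l % N)).image (fun i : ℕ => (i : ZMod N) + 1))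
  rw [card_image_of_injOn (inj _ _), card_image_of_injOn (inj _ _), sum_image (inj _ _)] at this
  simp_rw [sum_image (inj 1 l)] at this
  rw [e1]
  simp only [card_range] at this
  refine le_trans (le_of_eq ?_) (this.trans ?_)
  · congr 2
    refine sum_congr rfl fun a _ => sum_congr rfl fun b _ => ?_
    congr 1; push_cast; ring
  · gcongr <;> exact Nat.mod_le _ _

open Finset in
lemma sum_range_residue (L d c : ℕ) (hc : c < d) (g : ℕ → ℂ) :
    ∑ a ∈ range L with a % d = c, g a = ∑ i ∈ range ((L + d - 1 - c) / d), g (d * i + c) := by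
  have hd : 0 < d := by omega
  symm
  refine sum_nbij' (fun i => d * i + c) (fun a => a / d) ?_ ?_ ?_ ?_ ?_
  · intro i hi
    rw [mem_range, ← Nat.succ_le_iff, Nat.le_div_iff_mul_le hd, Nat.succ_mul, mul_comm] at hi
    simp only [mem_filter, mem_range]
    refine ⟨by omega, ?_⟩
    rw [Nat.mul_add_mod, Nat.mod_eq_of_lt hc]
  · intro a ha
    simp only [mem_filter, mem_range] at ha
    rw [mem_range, ← Nat.succ_le_iff, Nat.le_div_iff_mul_le hd, Nat.succ_mul, mul_comm]
    have := Nat.div_add_mod a d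
    omega
  · intro i _
    show (d * i + c) / d = i
    rw [Nat.mul_add_div hd, Nat.div_eq_of_lt hc, add_zero]
  · intro a ha
    simp only [mem_filter, mem_range] at ha
    show d * (a / d) + c = a
    rw [← ha.2]; exact Nat.div_add_mod a d
  · intro i _; rfl

open Finset in
lemma sum_dvd_split (L d : ℕ) (hd : 0 < d) (g : ℕ → ℂ) :
    ∑ a ∈ range L, ∑ b ∈ range L, (if d ∣ a + b + 1 then g (a + b + 1) else 0) =
    ∑ c ∈ range d, ∑ i ∈ range ((L + d - 1 - c) / d),
      ∑ j ∈ range ((L + d - 1 - (d - 1 - c)) / d), g (d * (i + j + 1)) := by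
  rw [← sum_fiberwise_of_maps_to (s := range L) (t := range d) (g := fun a => a % d)
    (fun a _ => mem_range.2 (Nat.mod_lt _ hd))]
  refine sum_congr rfl fun c hc => ?_
  have hc := mem_range.1 hc
  have h1 : ∀ a ∈ (range L).filter (fun a => a % d = c),
      ∑ b ∈ range L, (if d ∣ a + b + 1 then g (a + b + 1) else 0)
      = ∑ j ∈ range ((L + d - 1 - (d - 1 - c)) / d), g (a + (d * j + (d - 1 - c)) + 1) := by
    intro a ha
    rw [mem_filter] at ha
    rw [← sum_range_residue L d (d - 1 - c) (by omega) (fun b => g (a + b + 1)), sum_filter]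
    refine sum_congr rfl fun b _ => ?_
    congr 1
    rw [eq_iff_iff, Nat.dvd_iff_mod_eq_zero]
    have e : (a + b + 1) % d = (c + b % d + 1) % d := by
      rw [← ha.2]
      simp [Nat.add_mod]
    rw [e]
    have hb := Nat.mod_lt b hd
    constructor
    · intro h
      have := Nat.div_add_mod (c + b % d + 1) d
      rw [h] at this
      have h2 : (c + b % d + 1) / d < 2 := by
        rw [Nat.div_lt_iff_lt_mul hd]; omega
      interval_cases hq : (c + b % d + 1) / d <;> omega
    · intro h
      rw [h]
      have : c + (d - 1 - c) + 1 = d := by omega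
      rw [this, Nat.mod_self]
  rw [sum_congr rfl h1, sum_range_residue L d c hc]
  refine sum_congr rfl fun i _ => sum_congr rfl fun j _ => ?_
  congr 1
  rw [mul_add, mul_add]
  omega

open Finset in
lemma prim_bilinear_dvd {N : ℕ} [NeZero N] (χ : DirichletCharacter ℂ N) (hχ : χ.IsPrimitive)
    (h1 : χ ≠ 1) (L d : ℕ) (hd : 0 < d) :
    ‖∑ a ∈ range L, ∑ b ∈ range L, (if d ∣ a + b + 1 then χ (a + b + 1 : ℕ) else 0)‖
      ≤ 3 * L * √N := by
  by_cases hdL : 2 * L < d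
  · have : ∑ a ∈ range L, ∑ b ∈ range L, (if d ∣ a + b + 1 then χ (a + b + 1 : ℕ) else 0) = 0 := by
      refine sum_eq_zero fun a ha => sum_eq_zero fun b hb => if_neg fun h => ?_
      have := Nat.le_of_dvd (by omega) h
      rw [mem_range] at ha hb
      omega
    rw [this, norm_zero]; positivity
  push Not at hdL
  rw [sum_dvd_split L d hd (fun n => χ (n : ZMod N))]
  have hlen : ∀ c, (((L + d - 1 - c) / d : ℕ) : ℝ) ≤ L / d + 1 := by
    intro c
    have h2 : (L + d - 1 - c) / d ≤ (L + d) / d := Nat.div_le_div_right (by omega)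
    rw [Nat.add_div_right _ hd] at h2
    have h3 : ((L / d : ℕ) : ℝ) ≤ L / d := Nat.cast_div_le
    have : (((L + d - 1 - c) / d : ℕ) : ℝ) ≤ ((L / d + 1 : ℕ) : ℝ) := by exact_mod_cast h2
    push_cast at this
    linarith
  have hd' : (0 : ℝ) < d := by exact_mod_cast hd
  have hc : ∀ c ∈ range d, ‖∑ i ∈ range ((L + d - 1 - c) / d),
      ∑ j ∈ range ((L + d - 1 - (d - 1 - c)) / d), χ ((d * (i + j + 1) : ℕ) : ZMod N)‖
      ≤ √N * (L / d + 1) := by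
    intro c _
    have e : ∑ i ∈ range ((L + d - 1 - c) / d),
      ∑ j ∈ range ((L + d - 1 - (d - 1 - c)) / d), χ ((d * (i + j + 1) : ℕ) : ZMod N)
      = χ d * ∑ i ∈ range ((L + d - 1 - c) / d),
      ∑ j ∈ range ((L + d - 1 - (d - 1 - c)) / d), χ ((i + j + 1 : ℕ) : ZMod N) := by
      simp_rw [mul_sum]
      refine sum_congr rfl fun i _ => sum_congr rfl fun j _ => ?_
      rw [← map_mul]; push_cast; rfl
    rw [e, norm_mul]
    have hb := prim_bilinear_int χ hχ h1 ((L + d - 1 - c) / d) ((L + d - 1 - (d - 1 - c)) / d)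
    have hb2 : ‖∑ i ∈ range ((L + d - 1 - c) / d),
      ∑ j ∈ range ((L + d - 1 - (d - 1 - c)) / d), χ ((i + j + 1 : ℕ) : ZMod N)‖ ≤
        √N * (L / d + 1) := by
      refine abs_le_of_sq_le_sq' ?_ (by positivity) |>.2
      refine hb.trans ?_
      rw [mul_pow, Real.sq_sqrt (by positivity), sq]
      have := hlen c
      have := hlen (d - 1 - c)
      gcongr
    have h0 : ‖χ d‖ ≤ 1 := DirichletCharacter.norm_le_one _ _
    calc _ ≤ 1 * (√N * (L / d + 1)) := by gcongr
      _ = _ := one_mul _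
  refine (norm_sum_le _ _).trans ((sum_le_sum hc).trans ?_)
  rw [sum_const, card_range, nsmul_eq_mul]
  have : (d : ℝ) ≤ 2 * L := by exact_mod_cast hdL
  have e : (d : ℝ) * (√N * (L / d + 1)) = √N * (L + d) := by field_simp
  rw [e]
  nlinarith [Real.sqrt_nonneg N]

open Finset in
lemma coprime_pairs_le {m : ℕ} [NeZero m] (χ : DirichletCharacter ℂ m) (h1 : χ ≠ 1) (L : ℕ)
    (hL : ∀ n : ℕ, n < 2 * L → n.Coprime m → χ n = 1) :
    (∑ a ∈ range L, ∑ b ∈ range L, (if (a + b + 1).Coprime m then (1 : ℝ) else 0))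
      ≤ #{d ∈ m.divisors | Squarefree d} * (3 * L * √m) := by
  have : NeZero χ.conductor := ⟨χ.conductor_ne_zero⟩
  set ψ := χ.primitiveCharacter with hψ
  have hψp : ψ.IsPrimitive := χ.primitiveCharacter_isPrimitive
  have hψ1 : ψ ≠ 1 := by
    intro h
    apply h1
    rw [← χ.changeLevel_primitiveCharacter, ← hψ, h]
    simp
  have hψn : ∀ n : ℕ, n < 2 * L → n.Coprime m → ψ n = 1 := by
    intro n hn hc
    have := χ.primitiveCharacter_apply_of_isCoprime (a := n) (Nat.isCoprime_iff_coprime.2 hc)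
    rw [Int.cast_natCast, Int.cast_natCast] at this
    rw [hψ, this, hL n hn hc]
  have hmob : ∀ n : ℕ, 0 < n → (if n.Coprime m then (1 : ℂ) else 0)
      = ∑ d ∈ m.divisors with Squarefree d, ((ArithmeticFunction.moebius d : ℤ) : ℂ) *
          (if d ∣ n then 1 else 0) := by
    intro n hn
    have h2 : ∑ d ∈ (n.gcd m).divisors, (ArithmeticFunction.moebius d : ℤ)
        = if n.Coprime m then 1 else 0 := by
      rw [← ArithmeticFunction.coe_mul_zeta_apply, ArithmeticFunction.moebius_mul_coe_zeta,
        ArithmeticFunction.one_apply]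
    have h3 : (if n.Coprime m then (1 : ℂ) else 0) = ((if n.Coprime m then (1 : ℤ) else 0 : ℤ) : ℂ) := by
      split_ifs <;> simp
    rw [h3, ← h2]
    push_cast
    have h4 : (n.gcd m).divisors = m.divisors.filter (fun d => d ∣ n) := by
      ext d
      simp only [Nat.mem_divisors, mem_filter, Nat.dvd_gcd_iff]
      have := NeZero.ne m
      have : n.gcd m ≠ 0 := by positivity
      tauto
    rw [h4, sum_filter, sum_filter]
    refine sum_congr rfl fun d _ => ?_
    by_cases hs : Squarefree d
    · simp [hs]
    · simp [hs, ArithmeticFunction.moebius_eq_zero_of_not_squarefree hs]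
  have key : ((∑ a ∈ range L, ∑ b ∈ range L, (if (a + b + 1).Coprime m then (1 : ℝ) else 0) : ℝ) : ℂ)
      = ∑ d ∈ m.divisors with Squarefree d, ((ArithmeticFunction.moebius d : ℤ) : ℂ) *
        ∑ a ∈ range L, ∑ b ∈ range L, (if d ∣ a + b + 1 then ψ (a + b + 1 : ℕ) else 0) := by
    simp_rw [mul_sum]
    conv_rhs => rw [sum_comm]
    simp only [Complex.ofReal_sum]
    refine sum_congr rfl fun a ha => ?_
    conv_rhs => rw [sum_comm]
    refine sum_congr rfl fun b hb => ?_
    rw [mem_range] at ha hb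
    have e : ((if (a + b + 1).Coprime m then (1 : ℝ) else 0 : ℝ) : ℂ)
      = (if (a + b + 1).Coprime m then (1 : ℂ) else 0) * ψ (a + b + 1 : ℕ) := by
      split_ifs with h
      · rw [hψn _ (by omega) h]; simp
      · simp
    rw [e, hmob _ (by omega), sum_mul]
    refine sum_congr rfl fun d _ => ?_
    split_ifs <;> simp
  have hn : ‖((∑ a ∈ range L, ∑ b ∈ range L,
      (if (a + b + 1).Coprime m then (1 : ℝ) else 0) : ℝ) : ℂ)‖ =
      ∑ a ∈ range L, ∑ b ∈ range L, (if (a + b + 1).Coprime m then (1 : ℝ) else 0) := by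
    rw [Complex.norm_real, Real.norm_of_nonneg]
    exact sum_nonneg fun a _ => sum_nonneg fun b _ => by split_ifs <;> norm_num
  rw [← hn, key]
  refine (norm_sum_le _ _).trans ?_
  rw [← nsmul_eq_mul, ← sum_const]
  refine sum_le_sum fun d hd => ?_
  have hd0 : 0 < d := Nat.pos_of_mem_divisors (mem_filter.1 hd).1
  rw [norm_mul]
  have hμ : ‖((ArithmeticFunction.moebius d : ℤ) : ℂ)‖ ≤ 1 := by
    rw [Complex.norm_intCast]
    exact_mod_cast ArithmeticFunction.abs_moebius_le_one
  have hb := prim_bilinear_dvd ψ hψp hψ1 L d hd0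
  have hcm : (χ.conductor : ℝ) ≤ m := by
    exact_mod_cast Nat.le_of_dvd (Nat.pos_of_ne_zero (NeZero.ne m)) χ.conductor_dvd_level
  calc _ ≤ 1 * (3 * L * √χ.conductor) := by gcongr
    _ ≤ 3 * L * √m := by rw [one_mul]; gcongr

lemma cheb_lower {x : ℝ} (hx : 100 ≤ x) : x / (2 * Real.log x) ≤ Nat.primeCounting ⌊x⌋₊ := by
  have h1 := Chebyshev.pi_ge' (x := x) (by linarith)
  refine le_trans ?_ h1
  have hlog : 0 < Real.log x := Real.log_pos (by linarith)
  have h2 : x / (2 * Real.log x) = (x / 2) / Real.log x := by field_simp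
  rw [h2]
  refine div_le_div_of_nonneg_right ?_ hlog.le
  have h3 : Real.log ((x + 2) / 10) ≤ (x + 2) / 10 - 1 := Real.log_le_sub_one_of_pos (by linarith)
  rw [Real.log_div (by linarith) (by norm_num)] at h3
  have h4 : Real.log 10 ≤ 9 := by
    have := Real.log_le_sub_one_of_pos (x := 10) (by norm_num); linarith
  have h5 := Real.log_two_gt_d9
  have h6 := Real.log_two_lt_d9
  nlinarith

open Finset in
lemma two_pow_omega_le (δ : ℝ) (hδ : 0 < δ) : ∃ C : ℝ, 0 < C ∧ ∀ m : ℕ, 0 < m →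
    (2 : ℝ) ^ #m.primeFactors ≤ C * (m : ℝ) ^ δ := by
  set T : ℝ := 2 ^ (1 / δ) with hT
  refine ⟨2 ^ (⌊T⌋₊ + 1), by positivity, fun m hm => ?_⟩
  have h1 : ∀ p ∈ m.primeFactors, (2 : ℝ) ≤ (if p ∈ range (⌊T⌋₊ + 1) then 2 else 1) * (p : ℝ) ^ δ := by
    intro p hp
    have hp1 : (1 : ℝ) ≤ p := by exact_mod_cast (Nat.prime_of_mem_primeFactors hp).one_lt.le
    split_ifs with h
    · have := Real.one_le_rpow hp1 hδ.le
      linarith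
    · rw [mem_range, not_lt, Nat.succ_le_iff, Nat.floor_lt (by positivity)] at h
      rw [one_mul]
      calc (2 : ℝ) = T ^ δ := by
            rw [hT, ← Real.rpow_mul (by norm_num), one_div_mul_cancel hδ.ne', Real.rpow_one]
        _ ≤ _ := by gcongr
  calc (2 : ℝ) ^ #m.primeFactors = ∏ p ∈ m.primeFactors, (2 : ℝ) := by simp
    _ ≤ ∏ p ∈ m.primeFactors, ((if p ∈ range (⌊T⌋₊ + 1) then 2 else 1) * (p : ℝ) ^ δ) :=
        prod_le_prod (fun _ _ => by norm_num) h1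
    _ = (∏ p ∈ m.primeFactors, (if p ∈ range (⌊T⌋₊ + 1) then (2 : ℝ) else 1)) *
          ∏ p ∈ m.primeFactors, (p : ℝ) ^ δ := prod_mul_distrib
    _ ≤ 2 ^ (⌊T⌋₊ + 1) * (m : ℝ) ^ δ := by
        gcongr
        · rw [← prod_filter, prod_const]
          refine pow_le_pow_right₀ (by norm_num) ?_
          calc _ ≤ #(range (⌊T⌋₊ + 1)) := card_le_card (fun x hx => (mem_filter.1 hx).2)
            _ = _ := card_range _
        · rw [Real.finsetProd_rpow _ _ (fun _ _ => by positivity)]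
          gcongr
          rw [← Nat.cast_prod]
          exact Nat.cast_le.2 (Nat.le_of_dvd hm (Nat.prod_primeFactors_dvd m))

open Finset in
lemma card_sqfree_divisors_le (m : ℕ) : #{d ∈ m.divisors | Squarefree d} ≤ 2 ^ #m.primeFactors := by
  rw [← card_powerset]
  refine card_le_card_of_injOn Nat.primeFactors ?_ ?_
  · intro d hd
    simp only [coe_filter, Set.mem_ofPred_eq, Nat.mem_divisors] at hd
    simp only [mem_coe, mem_powerset]
    exact Nat.primeFactors_mono hd.1.1 hd.1.2
  · intro d hd e he h
    simp only [coe_filter, Set.mem_ofPred_eq, Nat.mem_divisors] at hd he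
    rw [← Nat.prod_primeFactors_of_squarefree hd.2, ← Nat.prod_primeFactors_of_squarefree he.2, h]

open Finset in
lemma coprime_pairs_ge (m : ℕ) (hm : 0 < m) (L K : ℕ) :
    (K : ℝ) * (Nat.primeCounting L - K - #m.primeFactors) ≤
    ∑ a ∈ range L, ∑ b ∈ range L, (if (a + b + 1).Coprime m then (1 : ℝ) else 0) := by
  set Q := {p ∈ range (L + 1) | p.Prime ∧ K < p ∧ p ∉ m.primeFactors} with hQ
  have hcard : (Nat.primeCounting L : ℝ) - K - #m.primeFactors ≤ #Q := by
    have h1 : Nat.primeCounting L = #{p ∈ range (L + 1) | p.Prime} := by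
      rw [Nat.primeCounting, Nat.primeCounting', Nat.count_eq_card_filter_range]
    have h2 : {p ∈ range (L + 1) | p.Prime} ⊆ (Q ∪ Ioc 0 K) ∪ m.primeFactors := by
      intro p hp
      rw [mem_filter] at hp
      have := hp.2.pos
      simp only [hQ, mem_union, mem_filter, mem_Ioc]
      by_cases h3 : p ∈ m.primeFactors
      · exact Or.inr h3
      · left
        rcases lt_or_ge K p with h | h
        · left; exact ⟨hp.1, hp.2, h, h3⟩
        · right; exact ⟨this, h⟩
    have h3 := (card_le_card h2).trans ((card_union_le _ _).trans
      (Nat.add_le_add_right (card_union_le _ _) _))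
    rw [← h1, Nat.card_Ioc] at h3
    have : (Nat.primeCounting L : ℝ) ≤ #Q + (K - 0 : ℕ) + #m.primeFactors := by exact_mod_cast h3
    simp at this
    linarith
  refine (mul_le_mul_of_nonneg_left hcard (by positivity)).trans ?_
  have hnn : ∀ a b : ℕ, (0 : ℝ) ≤ if (a + b + 1).Coprime m then (1 : ℝ) else 0 := by
    intro a b; split_ifs <;> norm_num
  rcases Q.eq_empty_or_nonempty with h0 | ⟨p0, hp0⟩
  · rw [h0]; simp only [card_empty, Nat.cast_zero, mul_zero]
    exact sum_nonneg fun a _ => sum_nonneg fun b _ => hnn a b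
  have hKL : K ≤ L := by
    simp only [hQ, mem_filter, mem_range] at hp0; omega
  calc (K : ℝ) * #Q = ∑ a ∈ range K, (#Q : ℝ) := by simp
    _ ≤ ∑ a ∈ range K, ∑ b ∈ range L, (if (a + b + 1).Coprime m then (1 : ℝ) else 0) := by
        refine sum_le_sum fun a ha => ?_
        rw [mem_range] at ha
        rw [← sum_filter, sum_const, nsmul_eq_mul, mul_one]
        norm_cast
        refine card_le_card_of_injOn (fun p => p - 1 - a) ?_ ?_
        · intro p hp
          simp only [hQ, coe_filter, Set.mem_ofPred_eq, mem_range] at hp ⊢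
          have e : a + (p - 1 - a) + 1 = p := by omega
          refine ⟨by omega, ?_⟩
          rw [e, Nat.Prime.coprime_iff_not_dvd hp.2.1]
          intro h
          exact hp.2.2.2 (Nat.mem_primeFactors.2 ⟨hp.2.1, h, hm.ne'⟩)
        · intro p hp q hq h
          simp only [hQ, coe_filter, Set.mem_ofPred_eq, mem_range] at hp hq
          simp only at h
          omega
    _ ≤ _ := sum_le_sum_of_subset_of_nonneg (by simpa using hKL)
        (fun a _ _ => sum_nonneg fun b _ => hnn a b)

open Finset Filter in
lemma coprime_pairs_large (δ : ℝ) (hδ : 0 < δ) : ∀ᶠ m : ℕ in atTop,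
    (#{d ∈ m.divisors | Squarefree d} : ℝ) * (3 * ⌊(m : ℝ) ^ (1 / 2 + δ) / 2⌋₊ * √m) <
    ∑ a ∈ range ⌊(m : ℝ) ^ (1 / 2 + δ) / 2⌋₊, ∑ b ∈ range ⌊(m : ℝ) ^ (1 / 2 + δ) / 2⌋₊,
      (if (a + b + 1).Coprime m then (1 : ℝ) else 0) := by
  obtain ⟨C, hC, hW⟩ := two_pow_omega_le (δ / 16) (by positivity)
  have hcast := tendsto_natCast_atTop_atTop (R := ℝ)
  have e1 : ∀ᶠ m : ℕ in atTop, (200 : ℝ) ≤ (m : ℝ) ^ (δ / 8) :=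
    ((tendsto_rpow_atTop (by positivity)).comp hcast).eventually_ge_atTop 200
  have e2 : ∀ᶠ m : ℕ in atTop, C ≤ (m : ℝ) ^ (δ / 16) :=
    ((tendsto_rpow_atTop (by positivity)).comp hcast).eventually_ge_atTop C
  have e3 : ∀ᶠ m : ℕ in atTop, Real.log m ≤ (1 / (1 / 2 + δ)) * (m : ℝ) ^ (δ / 8) := by
    have := (isLittleO_log_rpow_atTop (r := δ / 8) (by positivity)).bound
      (c := 1 / (1 / 2 + δ)) (by positivity)
    filter_upwards [hcast.eventually this] with m hm
    have h := (le_abs_self _).trans hm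
    rwa [Real.norm_of_nonneg (by positivity)] at h
  filter_upwards [e1, e2, e3, eventually_ge_atTop 1] with m h1 h2 h3 hm
  have hm0 : (0 : ℝ) < m := by exact_mod_cast hm
  have hm1 : (1 : ℝ) ≤ m := by exact_mod_cast hm
  set t := (m : ℝ) ^ (δ / 8) with ht
  set s := √(m : ℝ) with hs
  have hs1 : 1 ≤ s := by rw [hs]; exact Real.one_le_sqrt.2 hm1
  have hX : (m : ℝ) ^ (1 / 2 + δ) = s * t ^ 8 := by
    rw [hs, Real.sqrt_eq_rpow, ht, ← Real.rpow_natCast, ← Real.rpow_mul hm0.le,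
      ← Real.rpow_add hm0]
    congr 1; push_cast; ring
  have hWt : (2 : ℝ) ^ #m.primeFactors ≤ t := by
    refine (hW m hm).trans ?_
    calc C * (m : ℝ) ^ (δ / 16) ≤ (m : ℝ) ^ (δ / 16) * (m : ℝ) ^ (δ / 16) := by gcongr
      _ = t := by rw [← Real.rpow_add hm0, ht]; congr 1; ring
  have hlog : Real.log (s * t ^ 8 / 2) ≤ t := by
    have hst : 0 < s * t ^ 8 := by positivity
    calc Real.log (s * t ^ 8 / 2) ≤ Real.log (s * t ^ 8) := by
          apply Real.log_le_log (by positivity); linarith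
      _ = (1 / 2 + δ) * Real.log m := by rw [← hX, Real.log_rpow hm0]
      _ ≤ (1 / 2 + δ) * ((1 / (1 / 2 + δ)) * t) := by gcongr
      _ = t := by field_simp
  rw [hX]
  have ht8 : t ≤ t ^ 8 := le_self_pow₀ (by linarith) (by norm_num)
  have hbig : 100 ≤ s * t ^ 8 / 2 := by nlinarith
  have hpi := cheb_lower hbig
  have hlp : 0 < Real.log (s * t ^ 8 / 2) := Real.log_pos (by linarith)
  have hpi2 : s * t ^ 7 / 4 ≤ Nat.primeCounting ⌊s * t ^ 8 / 2⌋₊ := by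
    refine le_trans ?_ hpi
    rw [le_div_iff₀ (by positivity)]
    calc s * t ^ 7 / 4 * (2 * Real.log (s * t ^ 8 / 2)) ≤ s * t ^ 7 / 4 * (2 * t) := by gcongr
      _ = _ := by ring
  have hge := coprime_pairs_ge m hm ⌊s * t ^ 8 / 2⌋₊ ⌊s * t ^ 6⌋₊
  refine lt_of_lt_of_le ?_ hge
  have hω : (#m.primeFactors : ℝ) ≤ t := by
    refine le_trans ?_ hWt
    exact_mod_cast (Nat.lt_two_pow_self).le
  have hd : (#{d ∈ m.divisors | Squarefree d} : ℝ) ≤ t := by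
    refine le_trans ?_ hWt
    exact_mod_cast card_sqfree_divisors_le m
  have hLle : (⌊s * t ^ 8 / 2⌋₊ : ℝ) ≤ s * t ^ 8 / 2 := Nat.floor_le (by positivity)
  have hKle : (⌊s * t ^ 6⌋₊ : ℝ) ≤ s * t ^ 6 := Nat.floor_le (by positivity)
  have hKge : s * t ^ 6 / 2 ≤ (⌊s * t ^ 6⌋₊ : ℝ) := by
    have := (Nat.lt_floor_add_one (s * t ^ 6)).le
    have ht6 : t ≤ t ^ 6 := le_self_pow₀ (by linarith) (by norm_num)
    nlinarith
  have ht6 : t ≤ t ^ 6 := le_self_pow₀ (by linarith) (by norm_num)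
  have hst6 : t ≤ s * t ^ 6 := by nlinarith
  have hst7 : 50 * (s * t ^ 6) ≤ s * t ^ 7 / 4 := by
    have : s * t ^ 7 = t * (s * t ^ 6) := by ring
    rw [this]
    have : 0 ≤ s * t ^ 6 := by positivity
    nlinarith
  have hQ : s * t ^ 6 ≤ (Nat.primeCounting ⌊s * t ^ 8 / 2⌋₊ : ℝ) - ⌊s * t ^ 6⌋₊ - #m.primeFactors := by
    linarith
  calc _ ≤ t * (3 * (s * t ^ 8 / 2) * s) := by gcongr
    _ = (s ^ 2 * t ^ 9) * (3 / 2) := by ring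
    _ < (s ^ 2 * t ^ 9) * (t ^ 3 / 2) := by
        have : t ≤ t ^ 3 := le_self_pow₀ (by linarith) (by norm_num)
        gcongr; linarith
    _ = (s * t ^ 6 / 2) * (s * t ^ 6) := by ring
    _ ≤ _ := by gcongr

lemma exists_char_of_ne_top {m : ℕ} [NeZero m] (H : Subgroup (ZMod m)ˣ) (hH : H ≠ ⊤) :
    ∃ χ : DirichletCharacter ℂ m, χ ≠ 1 ∧ ∀ u ∈ H, χ (u : ZMod m) = 1 := by
  obtain ⟨u, hu⟩ : ∃ u, u ∉ H := by
    by_contra h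
    push Not at h
    exact hH (eq_top_iff.2 fun u _ => h u)
  have hne : (u : (ZMod m)ˣ ⧸ H) ≠ 1 := by
    rwa [Ne, QuotientGroup.eq_one_iff]
  have : NeZero (Monoid.exponent ((ZMod m)ˣ ⧸ H)) := by
    have hf : Finite ((ZMod m)ˣ ⧸ H) := Quotient.finite _
    exact ⟨Monoid.exponent_ne_zero_of_finite (G := (ZMod m)ˣ ⧸ H)⟩
  obtain ⟨φ, hφ⟩ := CommGroup.exists_apply_ne_one_of_hasEnoughRootsOfUnity
    ((ZMod m)ˣ ⧸ H) ℂ hne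
  refine ⟨MulChar.ofUnitHom (φ.comp (QuotientGroup.mk' H)), ?_, ?_⟩
  · intro h
    apply hφ
    have h2 : MulChar.ofUnitHom (φ.comp (QuotientGroup.mk' H)) (u : ZMod m) = 1 := by
      rw [h]; simp
    rw [MulChar.ofUnitHom_coe] at h2
    exact Units.val_eq_one.1 h2
  · intro v hv
    rw [MulChar.ofUnitHom_coe]
    have : (QuotientGroup.mk' H) v = 1 := by
      rw [QuotientGroup.mk'_apply, QuotientGroup.eq_one_iff]; exact hv
    simp [MonoidHom.comp_apply, this]

open Finset Filter in
lemma gen_primes (δ : ℝ) (hδ : 0 < δ) : ∀ᶠ m : ℕ in atTop,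
    Subgroup.closure {u : (ZMod m)ˣ | ∃ p : ℕ, p.Prime ∧ (p : ℝ) ≤ (m : ℝ) ^ (1 / 2 + δ) ∧
      (p : ZMod m) = u} = ⊤ := by
  filter_upwards [coprime_pairs_large δ hδ, eventually_ge_atTop 1] with m hlarge hm
  have : NeZero m := ⟨by omega⟩
  by_contra hne
  obtain ⟨χ, h1, hχ⟩ := exists_char_of_ne_top _ hne
  refine absurd (coprime_pairs_le χ h1 ⌊(m : ℝ) ^ (1 / 2 + δ) / 2⌋₊ ?_) (not_le.2 hlarge)
  intro n
  induction n using Nat.recOnMul with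
  | zero =>
    intro _ h
    have : m = 1 := by simpa using h
    subst this
    rw [show ((0 : ℕ) : ZMod 1) = 1 from Subsingleton.elim _ _]; simp
  | one => simp
  | prime p hp =>
    intro hlt hco
    have hle : (p : ℝ) ≤ (m : ℝ) ^ (1 / 2 + δ) := by
      have h2 := Nat.floor_le (a := (m : ℝ) ^ (1 / 2 + δ) / 2) (by positivity)
      have h3 : (p : ℝ) ≤ 2 * ⌊(m : ℝ) ^ (1 / 2 + δ) / 2⌋₊ := by exact_mod_cast hlt.le
      linarith
    have := hχ (ZMod.unitOfCoprime p hco) (Subgroup.subset_closure ⟨p, hp, hle, by simp⟩)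
    simpa using this
  | mul a b iha ihb =>
    intro hlt hco
    rcases Nat.eq_zero_or_pos a with ha | ha
    · subst ha; simp only [zero_mul] at *; exact iha hlt hco
    rcases Nat.eq_zero_or_pos b with hb | hb
    · subst hb; simp only [mul_zero] at *; exact ihb hlt hco
    push_cast
    rw [map_mul, iha (by nlinarith) (Nat.Coprime.coprime_mul_right hco),
      ihb (by nlinarith) (Nat.Coprime.coprime_mul_left hco), one_mul]

/-- Selberg weights for a divisor-closed set `P`. -/
noncomputable def selW (P : Finset ℕ) (y : ℕ → ℝ) (d : ℕ) : ℝ :=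
  d * ∑ k ∈ P with d ∣ k, (ArithmeticFunction.moebius (k / d) : ℝ) * y k

open Finset in
lemma moebius_between (k j : ℕ) (hj : 0 < j) (hkj : k ∣ j) :
    ∑ d ∈ j.divisors with k ∣ d, (ArithmeticFunction.moebius (j / d) : ℝ) = if j = k then 1 else 0 := by
  have hk : 0 < k := Nat.pos_of_dvd_of_pos hkj hj
  obtain ⟨t, rfl⟩ := hkj
  have ht : 0 < t := Nat.pos_of_mul_pos_left hj
  have h1 : ∑ d ∈ (k * t).divisors with k ∣ d, (ArithmeticFunction.moebius (k * t / d) : ℝ)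
      = ∑ e ∈ t.divisors, (ArithmeticFunction.moebius (t / e) : ℝ) := by
    symm
    refine sum_bij (fun e _ => k * e) ?_ ?_ ?_ ?_
    · intro e he
      rw [Nat.mem_divisors] at he
      simp only [mem_filter, Nat.mem_divisors]
      exact ⟨⟨Nat.mul_dvd_mul_left k he.1, hj.ne'⟩, dvd_mul_right _ _⟩
    · intro a _ b _ h; exact Nat.eq_of_mul_eq_mul_left hk h
    · intro d hd
      simp only [mem_filter, Nat.mem_divisors] at hd
      obtain ⟨e, rfl⟩ := hd.2
      exact ⟨e, by rw [Nat.mem_divisors]; exact ⟨Nat.dvd_of_mul_dvd_mul_left hk hd.1.1, ht.ne'⟩, rfl⟩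
    · intro e _
      rw [Nat.mul_div_mul_left _ _ hk]
  rw [h1, Nat.sum_div_divisors t (fun e => (ArithmeticFunction.moebius e : ℝ)),
    ← Int.cast_sum]
  have h2 : ∑ i ∈ t.divisors, ArithmeticFunction.moebius i = if t = 1 then 1 else 0 := by
    rw [← ArithmeticFunction.coe_mul_zeta_apply, ArithmeticFunction.moebius_mul_coe_zeta,
      ArithmeticFunction.one_apply]
  rw [h2]
  have h3 : k * t = k ↔ t = 1 := by
    constructor
    · intro h; exact Nat.eq_of_mul_eq_mul_left hk (by omega)
    · rintro rfl; omega
  simp only [h3]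
  split_ifs <;> simp

open Finset in
lemma selW_inv (P : Finset ℕ) (hpos : ∀ k ∈ P, 0 < k) (hdiv : ∀ k ∈ P, ∀ d, d ∣ k → d ∈ P)
    (y : ℕ → ℝ) (k : ℕ) (hk : k ∈ P) : ∑ d ∈ P with k ∣ d, selW P y d / d = y k := by
  have h1 : ∀ d ∈ P, selW P y d / d = ∑ j ∈ P with d ∣ j, (ArithmeticFunction.moebius (j / d) : ℝ) * y j := by
    intro d hd
    have := hpos d hd
    rw [selW]; field_simp
  calc _ = ∑ d ∈ P with k ∣ d, ∑ j ∈ P with d ∣ j, (ArithmeticFunction.moebius (j / d) : ℝ) * y j :=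
        sum_congr rfl fun d hd => h1 d (mem_filter.1 hd).1
    _ = ∑ j ∈ P with k ∣ j, ∑ d ∈ j.divisors with k ∣ d, (ArithmeticFunction.moebius (j / d) : ℝ) * y j := by
        refine sum_comm' ?_
        intro d j
        simp only [mem_filter, Nat.mem_divisors]
        constructor
        · rintro ⟨⟨h1, h2⟩, h3, h4⟩
          exact ⟨⟨⟨h4, (hpos j h3).ne'⟩, h2⟩, h3, h2.trans h4⟩
        · rintro ⟨⟨⟨h1, h2⟩, h3⟩, h4, h5⟩
          exact ⟨⟨hdiv j h4 d h1, h3⟩, h4, h1⟩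
    _ = ∑ j ∈ P with k ∣ j, (if j = k then 1 else 0) * y j := by
        refine sum_congr rfl fun j hj => ?_
        rw [mem_filter] at hj
        rw [← sum_mul, moebius_between k j (hpos j hj.1) hj.2]
    _ = y k := by
        simp only [ite_mul, one_mul, zero_mul]
        rw [sum_ite_eq' _ k]
        simp [hk]

open Finset in
lemma quad_form (P : Finset ℕ) (hpos : ∀ k ∈ P, 0 < k) (hdiv : ∀ k ∈ P, ∀ d, d ∣ k → d ∈ P)
    (l : ℕ → ℝ) : ∑ d ∈ P, ∑ e ∈ P, l d * l e / (d.lcm e : ℕ) =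
      ∑ k ∈ P, (k.totient : ℝ) * (∑ d ∈ P with k ∣ d, l d / d) ^ 2 := by
  have h1 : ∀ d ∈ P, ∀ e ∈ P, l d * l e / (d.lcm e : ℕ) =
      ∑ k ∈ P, (k.totient : ℝ) * ((if k ∣ d then l d / d else 0) * (if k ∣ e then l e / e else 0)) := by
    intro d hd e he
    have hd0 := hpos d hd
    have he0 := hpos e he
    have hg : 0 < d.gcd e := Nat.gcd_pos_of_pos_left _ hd0
    have h2 : ∑ k ∈ P, (k.totient : ℝ) * ((if k ∣ d then l d / d else 0) * (if k ∣ e then l e / e else 0))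
        = ∑ k ∈ (d.gcd e).divisors, (k.totient : ℝ) * (l d / d * (l e / e)) := by
      have : ∀ k ∈ P, (k.totient : ℝ) * ((if k ∣ d then l d / d else 0) * (if k ∣ e then l e / e else 0))
        = if k ∣ d.gcd e then (k.totient : ℝ) * (l d / d * (l e / e)) else 0 := by
        intro k _
        by_cases a : k ∣ d <;> by_cases b : k ∣ e <;> simp [a, b, Nat.dvd_gcd_iff]
      rw [sum_congr rfl this, ← sum_filter]
      refine sum_congr ?_ fun _ _ => rfl
      ext k
      simp only [mem_filter, Nat.mem_divisors]
      constructor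
      · rintro ⟨_, h⟩; exact ⟨h, hg.ne'⟩
      · rintro ⟨h, _⟩; exact ⟨hdiv d hd k (h.trans (Nat.gcd_dvd_left _ _)), h⟩
    rw [h2, ← sum_mul, ← Nat.cast_sum, Nat.sum_totient]
    have h3 : (d.gcd e : ℝ) * (d.lcm e : ℕ) = d * e := by exact_mod_cast Nat.gcd_mul_lcm d e
    have h4 : (0 : ℝ) < d.lcm e := by exact_mod_cast Nat.lcm_pos hd0 he0
    have h5 : (0 : ℝ) < d := by exact_mod_cast hd0
    have h6 : (0 : ℝ) < e := by exact_mod_cast he0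
    field_simp
    linear_combination (-(l d * l e)) * h3
  rw [sum_congr rfl fun d hd => sum_congr rfl fun e he => h1 d hd e he]
  have : ∀ d ∈ P, ∑ e ∈ P, ∑ k ∈ P, (k.totient : ℝ) * ((if k ∣ d then l d / d else 0) * (if k ∣ e then l e / e else 0))
    = ∑ k ∈ P, ∑ e ∈ P, (k.totient : ℝ) * ((if k ∣ d then l d / d else 0) * (if k ∣ e then l e / e else 0)) :=
    fun d _ => sum_comm
  rw [sum_congr rfl this, sum_comm]
  refine sum_congr rfl fun k _ => ?_
  rw [sum_filter, sq, sum_mul_sum, mul_sum]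
  refine sum_congr rfl fun d _ => ?_
  rw [mul_sum]

open Finset in
lemma sel_weights (P : Finset ℕ) (h1 : 1 ∈ P) (hsq : ∀ k ∈ P, Squarefree k)
    (hdiv : ∀ k ∈ P, ∀ d, d ∣ k → d ∈ P) :
    ∃ l : ℕ → ℝ, l 1 = 1 ∧ (∀ d ∈ P, |l d| ≤ d) ∧
      ∑ d ∈ P, ∑ e ∈ P, l d * l e / (d.lcm e : ℕ) = 1 / ∑ k ∈ P, 1 / (k.totient : ℝ) := by
  have hpos : ∀ k ∈ P, 0 < k := fun k hk => Nat.pos_of_ne_zero (hsq k hk).ne_zero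
  have htp : ∀ k ∈ P, (0 : ℝ) < k.totient := fun k hk => by
    exact_mod_cast Nat.totient_pos.2 (hpos k hk)
  set V : ℝ := ∑ k ∈ P, 1 / (k.totient : ℝ) with hV
  have hVpos : 0 < V := sum_pos (fun k hk => by have := htp k hk; positivity) ⟨1, h1⟩
  set y : ℕ → ℝ := fun k => (ArithmeticFunction.moebius k : ℝ) / (k.totient * V) with hy
  have hmu : ∀ k ∈ P, (ArithmeticFunction.moebius k : ℝ) ^ 2 = 1 := by
    intro k hk
    have := ArithmeticFunction.moebius_sq_eq_one_of_squarefree (hsq k hk)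
    exact_mod_cast this
  refine ⟨selW P y, ?_, ?_, ?_⟩
  · rw [selW]
    simp only [Nat.cast_one, one_mul, one_dvd, filter_true, Nat.div_one]
    calc _ = ∑ k ∈ P, (1 / (k.totient : ℝ)) * (1 / V) := by
          refine sum_congr rfl fun k hk => ?_
          have := htp k hk
          have h2 := hmu k hk
          simp only [hy]
          field_simp
          linarith
      _ = 1 := by rw [← sum_mul, ← hV]; field_simp
  · intro d hd
    rw [selW, abs_mul, Nat.abs_cast]
    refine mul_le_of_le_one_right (by positivity) ?_
    calc _ ≤ ∑ k ∈ P with d ∣ k, |(ArithmeticFunction.moebius (k / d) : ℝ) * y k| := abs_sum_le_sum_abs _ _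
      _ ≤ ∑ k ∈ P with d ∣ k, (1 / (k.totient : ℝ)) * (1 / V) := by
          refine sum_le_sum fun k hk => ?_
          have hkP := (mem_filter.1 hk).1
          have := htp k hkP
          have b1 : |(ArithmeticFunction.moebius (k / d) : ℝ)| ≤ 1 := by
            exact_mod_cast ArithmeticFunction.abs_moebius_le_one
          have b2 : |y k| ≤ (1 / (k.totient : ℝ)) * (1 / V) := by
            simp only [hy]
            rw [abs_div, abs_of_pos (by positivity : (0:ℝ) < k.totient * V), div_mul_div_comm, one_mul]
            gcongr
            exact_mod_cast ArithmeticFunction.abs_moebius_le_one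
          rw [abs_mul]
          calc _ ≤ 1 * ((1 / (k.totient : ℝ)) * (1 / V)) := by gcongr
            _ = _ := one_mul _
      _ ≤ ∑ k ∈ P, (1 / (k.totient : ℝ)) * (1 / V) :=
          sum_le_sum_of_subset_of_nonneg (filter_subset _ _) fun k hk _ => by
            have := htp k hk; positivity
      _ = 1 := by rw [← sum_mul, ← hV]; field_simp
  · rw [quad_form P hpos hdiv]
    calc _ = ∑ k ∈ P, (1 / (k.totient : ℝ)) * (1 / V ^ 2) := by
          refine sum_congr rfl fun k hk => ?_
          have := htp k hk
          have h2 := hmu k hk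
          rw [selW_inv P hpos hdiv y k hk]
          simp only [hy]
          rw [div_pow, h2]
          field_simp
      _ = 1 / V := by rw [← sum_mul, ← hV]; field_simp

open Finset in
lemma ap_count (m a N q : ℕ) (hm : 0 < m) (hq : 0 < q) (hc : q.Coprime m) :
    |(#{n ∈ range N | n ≡ a [MOD m] ∧ q ∣ n} : ℝ) - (N : ℝ) / m / q| ≤ 1 := by
  set c := Nat.chineseRemainder hc 0 a with hcdef
  have h1 : ∀ n, (n ≡ a [MOD m] ∧ q ∣ n) ↔ n ≡ c [MOD (q * m)] := by
    intro n
    rw [← Nat.modEq_and_modEq_iff_modEq_mul hc, ← Nat.modEq_zero_iff_dvd]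
    constructor
    · rintro ⟨h2, h3⟩
      exact ⟨h3.trans c.2.1.symm, h2.trans c.2.2.symm⟩
    · rintro ⟨h2, h3⟩
      exact ⟨h3.trans c.2.2, h2.trans c.2.1⟩
  have h2 : #{n ∈ range N | n ≡ a [MOD m] ∧ q ∣ n} =
      N / (q * m) + if (c : ℕ) % (q * m) < N % (q * m) then 1 else 0 := by
    rw [← Nat.count_modEq_card N (by positivity), Nat.count_eq_card_filter_range]
    simp only [h1]
  have hqm : (0 : ℝ) < q * m := by positivity
  have h3 : (N : ℝ) / m / q = N / (q * m) := by rw [div_div, mul_comm]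
  have h4 : ((N / (q * m) : ℕ) : ℝ) ≤ N / (q * m) := by
    have := @Nat.cast_div_le ℝ _ _ _ N (q * m); push_cast at this; exact this
  have h5 : (N : ℝ) / (q * m) < ((N / (q * m) : ℕ) : ℝ) + 1 := by
    rw [div_lt_iff₀ hqm]
    have := Nat.lt_div_mul_add (a := N) (b := q * m) (by positivity)
    have h6 : (N : ℝ) < ((N / (q * m) * (q * m) + q * m : ℕ) : ℝ) := by exact_mod_cast this
    push_cast at h6
    linarith
  have h7 : ((if (c : ℕ) % (q * m) < N % (q * m) then 1 else 0 : ℕ) : ℝ) ≤ 1 ∧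
      (0 : ℝ) ≤ ((if (c : ℕ) % (q * m) < N % (q * m) then 1 else 0 : ℕ) : ℝ) := by
    split_ifs <;> simp
  rw [h2, h3, Nat.cast_add, abs_le]
  constructor <;> linarith [h7.1, h7.2]

open Finset in
lemma sieve_bound (m a N D : ℕ) (hm : 0 < m) (hD : 1 ≤ D) (T : Finset ℕ)
    (hT : ∀ n ∈ T, n < N ∧ n ≡ a [MOD m] ∧ ∀ p, p.Prime → p ≤ D → ¬ p ∣ n) :
    (#T : ℝ) ≤
      (N : ℝ) / m / (∑ k ∈ Icc 1 D with Squarefree k ∧ k.Coprime m, 1 / (k.totient : ℝ)) + (D : ℝ) ^ 4 := by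
  set P := {k ∈ Icc 1 D | Squarefree k ∧ k.Coprime m} with hP
  have memP : ∀ k, k ∈ P ↔ (1 ≤ k ∧ k ≤ D) ∧ Squarefree k ∧ k.Coprime m := by
    intro k; simp [hP]
  have h1 : 1 ∈ P := by rw [memP]; simp [hD]
  obtain ⟨l, hl1, hlb, hlq⟩ := sel_weights P h1 (fun k hk => ((memP k).1 hk).2.1) (by
    intro k hk d hd
    rw [memP] at hk ⊢
    have := Nat.le_of_dvd hk.1.1 hd
    have h0 := Nat.pos_of_dvd_of_pos hd hk.1.1
    exact ⟨⟨h0, by omega⟩, hk.2.1.squarefree_of_dvd hd, hk.2.2.coprime_dvd_left hd⟩)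
  set R := {n ∈ range N | n ≡ a [MOD m]} with hR
  have step1 : (#T : ℝ) ≤
      ∑ n ∈ R, (∑ d ∈ P with d ∣ n, l d) ^ 2 := by
    calc _ = ∑ n ∈ T, (1 : ℝ) := by simp
      _ = ∑ n ∈ T, (∑ d ∈ P with d ∣ n, l d) ^ 2 := by
          refine sum_congr rfl fun n hn => ?_
          replace hn := hT n hn
          have : {d ∈ P | d ∣ n} = {1} := by
            ext d
            simp only [mem_filter, mem_singleton]
            constructor
            · rintro ⟨h2, h3⟩
              by_contra h4
              obtain ⟨p, hp, hpd⟩ := Nat.exists_prime_and_dvd h4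
              rw [memP] at h2
              exact hn.2.2 p hp ((Nat.le_of_dvd h2.1.1 hpd).trans h2.1.2) (hpd.trans h3)
            · rintro rfl; exact ⟨h1, one_dvd _⟩
          rw [this, sum_singleton, hl1]; norm_num
      _ ≤ _ := sum_le_sum_of_subset_of_nonneg (fun n hn => by
          rw [hR, mem_filter, mem_range]; exact ⟨(hT n hn).1, (hT n hn).2.1⟩) fun _ _ _ => sq_nonneg _
  have step2 : ∑ n ∈ R, (∑ d ∈ P with d ∣ n, l d) ^ 2 =
      ∑ d ∈ P, ∑ e ∈ P, l d * l e * (#{n ∈ range N | n ≡ a [MOD m] ∧ d.lcm e ∣ n} : ℝ) := by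
    have : ∀ n ∈ R, (∑ d ∈ P with d ∣ n, l d) ^ 2 =
        ∑ d ∈ P, ∑ e ∈ P, (if d.lcm e ∣ n then l d * l e else 0) := by
      intro n _
      rw [sum_filter, sq, sum_mul_sum]
      refine sum_congr rfl fun d _ => sum_congr rfl fun e _ => ?_
      simp only [Nat.lcm_dvd_iff]
      by_cases x : d ∣ n <;> by_cases z : e ∣ n <;> simp [x, z]
    rw [sum_congr rfl this, sum_comm]
    refine sum_congr rfl fun d _ => ?_
    rw [sum_comm]
    refine sum_congr rfl fun e _ => ?_
    rw [← sum_filter, sum_const, hR, filter_filter, nsmul_eq_mul, mul_comm]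
  rw [step2] at step1
  refine step1.trans ?_
  have step3 : ∀ d ∈ P, ∀ e ∈ P, l d * l e * (#{n ∈ range N | n ≡ a [MOD m] ∧ d.lcm e ∣ n} : ℝ) ≤
      (N : ℝ) / m * (l d * l e / (d.lcm e : ℕ)) + (D : ℝ) ^ 2 := by
    intro d hd e he
    have hd' := (memP d).1 hd
    have he' := (memP e).1 he
    have hc := ap_count m a N (d.lcm e) hm (Nat.lcm_pos hd'.1.1 he'.1.1)
      (Nat.Coprime.coprime_dvd_left (Nat.lcm_dvd_mul d e) (Nat.Coprime.mul_left hd'.2.2 he'.2.2))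
    have hb : |l d * l e| ≤ (D : ℝ) ^ 2 := by
      rw [abs_mul, sq]
      have x1 : (d : ℝ) ≤ D := by exact_mod_cast hd'.1.2
      have x2 : (e : ℝ) ≤ D := by exact_mod_cast he'.1.2
      have := hlb d hd
      have := hlb e he
      gcongr <;> linarith
    set A : ℝ := (#{n ∈ range N | n ≡ a [MOD m] ∧ d.lcm e ∣ n} : ℝ)
    have h3 : l d * l e * (A - (N : ℝ) / m / (d.lcm e : ℕ)) ≤ (D : ℝ) ^ 2 := by
      refine (le_abs_self _).trans ?_
      rw [abs_mul]
      calc _ ≤ (D : ℝ) ^ 2 * 1 := by gcongr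
        _ = _ := mul_one _
    have h4 : l d * l e * (A - (N : ℝ) / m / (d.lcm e : ℕ)) =
      l d * l e * A - (N : ℝ) / m * (l d * l e / (d.lcm e : ℕ)) := by ring
    linarith
  refine (sum_le_sum fun d hd => sum_le_sum fun e he => step3 d hd e he).trans ?_
  simp only [sum_add_distrib, ← mul_sum]
  rw [hlq]
  have hcard : (#P : ℝ) ≤ D := by
    have : #P ≤ #(Icc 1 D) := card_filter_le _ _
    rw [Nat.card_Icc] at this
    exact_mod_cast this
  simp only [sum_const, nsmul_eq_mul]
  have : (#P : ℝ) * (#P * (D : ℝ) ^ 2) ≤ (D : ℝ) ^ 4 := by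
    calc _ ≤ (D : ℝ) * (D * (D : ℝ) ^ 2) := by gcongr
      _ = _ := by ring
  have h9 : (N : ℝ) / m * (1 / ∑ k ∈ P, 1 / (k.totient : ℝ)) = (N : ℝ) / m / ∑ k ∈ P, 1 / (k.totient : ℝ) := by
    rw [mul_one_div]
  linarith

open Finset in
lemma sum_inv_factored_le (M : ℕ) (hM : 0 < M) (F : Finset ℕ)
    (hF : ∀ k ∈ F, k ∈ Nat.factoredNumbers M.primeFactors) :
    ∑ k ∈ F, (1 : ℝ) / k ≤ (M : ℝ) / M.totient := by
  set f : ℕ →* ℝ := ⟨⟨fun n => ((n : ℝ))⁻¹, by simp⟩, fun a b => by simp [mul_comm]⟩ with hf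
  have hfa : ∀ n, f n = (n : ℝ)⁻¹ := fun n => rfl
  have hsum := (EulerProduct.summable_and_hasSum_factoredNumbers_prod_filter_prime_geometric
    (f := f) (by
      intro p hp
      rw [hfa, norm_inv, Real.norm_natCast]
      exact inv_lt_one_of_one_lt₀ (by exact_mod_cast hp.one_lt)) M.primeFactors).2
  have h1 : {p ∈ M.primeFactors | p.Prime} = M.primeFactors :=
    filter_true_of_mem fun p hp => Nat.prime_of_mem_primeFactors hp
  have hφ : (0 : ℝ) < M.totient := by exact_mod_cast Nat.totient_pos.2 hM
  have h2 : ∏ p ∈ M.primeFactors, (1 - f p)⁻¹ = (M : ℝ) / M.totient := by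
    have h3 : (M.totient : ℝ) = M * ∏ p ∈ M.primeFactors, (1 - (p : ℝ)⁻¹) := by
      have := congrArg (fun q : ℚ => (q : ℝ)) (Nat.totient_eq_mul_prod_factors M)
      push_cast at this
      exact this
    simp only [hfa, prod_inv_distrib]
    have h4 : ∏ p ∈ M.primeFactors, (1 - (p : ℝ)⁻¹) ≠ 0 := by
      intro h; rw [h] at h3; simp at h3; omega
    rw [eq_div_iff hφ.ne', h3, mul_left_comm, inv_mul_cancel₀ h4, mul_one]
  rw [h1, h2] at hsum
  have h5 := sum_le_hasSum (F.subtype (· ∈ Nat.factoredNumbers M.primeFactors))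
    (fun i _ => by rw [hfa]; positivity) hsum
  rw [sum_subtype_of_mem (fun k => f k) hF] at h5
  simpa [hfa] using h5

open Finset in
lemma V_lower (m D : ℕ) (hm : 0 < m) : Real.log D ≤ (m : ℝ) / m.totient *
    ∑ k ∈ Icc 1 D with Squarefree k ∧ k.Coprime m, 1 / (k.totient : ℝ) := by
  set P := {k ∈ Icc 1 D | Squarefree k ∧ k.Coprime m} with hP
  have hharm : Real.log D ≤ ∑ n ∈ Icc 1 D, (1 : ℝ) / n := by
    have h1 := log_add_one_le_harmonic D
    rw [harmonic_eq_sum_Icc] at h1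
    push_cast at h1
    rcases Nat.eq_zero_or_pos D with h | h
    · subst h; simp
    have h2 : Real.log D ≤ Real.log (D + 1) := by
      apply Real.log_le_log (by exact_mod_cast h); linarith
    simp only [one_div]
    linarith
  refine hharm.trans ?_
  set g : ℕ → ℕ := fun n => ∏ p ∈ n.primeFactors with ¬ p ∣ m, p with hg
  have hgpr : ∀ n : ℕ, ∀ p ∈ {p ∈ n.primeFactors | ¬ p ∣ m}, p.Prime := fun n p hp =>
    Nat.prime_of_mem_primeFactors (mem_filter.1 hp).1
  have hgd : ∀ n, g n ∣ n := fun n =>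
    (prod_dvd_prod_of_subset _ _ _ (filter_subset _ _)).trans (Nat.prod_primeFactors_dvd n)
  have hgf : ∀ n, (g n).primeFactors = {p ∈ n.primeFactors | ¬ p ∣ m} := fun n =>
    Nat.primeFactors_prod (hgpr n)
  have hmaps : ∀ n ∈ Icc 1 D, g n ∈ P := by
    intro n hn
    rw [mem_Icc] at hn
    rw [hP, mem_filter, mem_Icc]
    have h0 := Nat.pos_of_dvd_of_pos (hgd n) hn.1
    refine ⟨⟨h0, (Nat.le_of_dvd hn.1 (hgd n)).trans hn.2⟩, ?_, ?_⟩
    · refine Finset.squarefree_prod_of_pairwise_isCoprime (fun p hp q hq hpq => ?_) fun p hp =>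
        (hgpr n p hp).prime.squarefree
      exact Nat.coprime_iff_isRelPrime.1 ((Nat.coprime_primes (hgpr n p hp) (hgpr n q hq)).2 hpq)
    · refine Nat.Coprime.prod_left fun p hp => ?_
      rw [Nat.Prime.coprime_iff_not_dvd (hgpr n p hp)]
      exact (mem_filter.1 hp).2
  rw [← sum_fiberwise_of_maps_to hmaps, mul_sum]
  refine sum_le_sum fun l hl => ?_
  rw [hP, mem_filter, mem_Icc] at hl
  have hl0 : 0 < l := hl.1.1
  have hlR : (0 : ℝ) < l := by exact_mod_cast hl0
  have hF := sum_inv_factored_le (l * m) (by positivity)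
    (image (fun n => n / l) {n ∈ Icc 1 D | g n = l}) (by
      intro k hk
      rw [mem_image] at hk
      obtain ⟨n, hn, rfl⟩ := hk
      rw [mem_filter, mem_Icc] at hn
      have hdn : l ∣ n := hn.2 ▸ hgd n
      have hn0 : n ≠ 0 := by omega
      refine Nat.mem_factoredNumbers_of_primeFactors_subset ?_ ?_
      · exact (Nat.div_pos (Nat.le_of_dvd hn.1.1 hdn) hl0).ne'
      · intro p hp
        have hpn : p ∈ n.primeFactors := Nat.primeFactors_mono (Nat.div_dvd_of_dvd hdn) hn0 hp
        have hpp := Nat.prime_of_mem_primeFactors hp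
        rw [Nat.mem_primeFactors]
        refine ⟨hpp, ?_, by positivity⟩
        by_cases hpm : p ∣ m
        · exact hpm.mul_left _
        · have : p ∈ (g n).primeFactors := by rw [hgf, mem_filter]; exact ⟨hpn, hpm⟩
          rw [hn.2] at this
          exact (Nat.dvd_of_mem_primeFactors this).mul_right _)
  rw [sum_image (by
    intro a ha b hb h
    simp only [coe_filter, Set.mem_ofPred_eq] at ha hb
    have h1 : l ∣ a := ha.2 ▸ hgd a
    have h2 : l ∣ b := hb.2 ▸ hgd b
    exact (Nat.div_left_inj h1 h2).1 h)] at hF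
  have e1 : ∑ n ∈ Icc 1 D with g n = l, (1 : ℝ) / n =
      (1 / l) * ∑ n ∈ Icc 1 D with g n = l, (1 : ℝ) / ((n / l : ℕ) : ℝ) := by
    rw [mul_sum]
    refine sum_congr rfl fun n hn => ?_
    rw [mem_filter, mem_Icc] at hn
    have hdn : l ∣ n := hn.2 ▸ hgd n
    rw [Nat.cast_div hdn hlR.ne']
    have : (0 : ℝ) < n := by exact_mod_cast hn.1.1
    field_simp
  rw [e1]
  calc _ ≤ (1 / (l : ℝ)) * (((l * m : ℕ) : ℝ) / (l * m).totient) := by gcongr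
    _ = _ := by
      rw [Nat.totient_mul hl.2.2]
      have : (0 : ℝ) < l.totient := by exact_mod_cast Nat.totient_pos.2 hl0
      have : (0 : ℝ) < m.totient := by exact_mod_cast Nat.totient_pos.2 hm
      push_cast
      field_simp

open Filter in
lemma theta_lower_ev : ∀ᶠ x : ℝ in atTop, (3 / 5) * x ≤ Chebyshev.theta x := by
  have h := (isLittleO_log_rpow_atTop (r := 1 / 2) (by positivity)).bound
      (c := 1 / 1000) (by positivity)
  filter_upwards [h, eventually_ge_atTop 1000] with x hx hx1
  have h1 := Chebyshev.theta_ge' (x := x) (by linarith)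
  have hx0 : 0 ≤ x := by linarith
  rw [← Real.sqrt_eq_rpow] at hx
  have h2 : Real.log x ≤ 1 / 1000 * √x := by
    have := (le_abs_self _).trans hx
    rwa [Real.norm_of_nonneg (by positivity)] at this
  have h3 : Real.log (x + 2) ≤ 2 * Real.log x := by
    have : 2 * Real.log x = Real.log (x ^ 2) := by rw [Real.log_pow]; norm_num
    rw [this]
    apply Real.log_le_log (by linarith); nlinarith
  have h4 := Real.sq_sqrt hx0
  have h5 : √x * Real.log x ≤ 1 / 1000 * x := by
    calc _ ≤ √x * (1 / 1000 * √x) := by gcongr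
      _ = 1 / 1000 * (√x) ^ 2 := by ring
      _ = _ := by rw [h4]
  have h6 : √x ≤ x := by
    have : 1 ≤ √x := Real.one_le_sqrt.2 (by linarith)
    nlinarith
  have := Real.log_two_gt_d9
  nlinarith

open Filter Finset in
lemma prime_block : ∃ X₀ : ℝ, 1 ≤ X₀ ∧ ∀ X : ℝ, X₀ ≤ X →
    1 / (4 * Real.log (4 * X)) ≤ ∑ p ∈ Ioc ⌊X⌋₊ ⌊4 * X⌋₊ with p.Prime, (1 : ℝ) / p := by
  obtain ⟨X₀, hX⟩ := eventually_atTop.1 theta_lower_ev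
  refine ⟨max X₀ 1, le_max_right _ _, fun X hX1 => ?_⟩
  have hX2 : 1 ≤ X := (le_max_right _ _).trans hX1
  have h1 := hX (4 * X) (by linarith [le_max_left X₀ 1])
  have h2 := Chebyshev.theta_le_log4_mul_x (x := X) (by linarith)
  have h3 : Real.log 4 ≤ 1.39 := by
    have : Real.log 4 = 2 * Real.log 2 := by
      rw [← Real.log_rpow (by norm_num)]; norm_num
    rw [this]; linarith [Real.log_two_lt_d9]
  have hfl : ⌊X⌋₊ ≤ ⌊4 * X⌋₊ := Nat.floor_mono (by linarith)
  have h4 : Chebyshev.theta (4 * X) = Chebyshev.theta X +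
      ∑ p ∈ Ioc ⌊X⌋₊ ⌊4 * X⌋₊ with p.Prime, Real.log p := by
    rw [Chebyshev.theta, Chebyshev.theta, sum_filter, sum_filter, sum_filter]
    exact (sum_Ioc_consecutive _ (Nat.zero_le _) hfl).symm
  have h5 : X ≤ ∑ p ∈ Ioc ⌊X⌋₊ ⌊4 * X⌋₊ with p.Prime, Real.log p := by nlinarith
  have hl : 0 < Real.log (4 * X) := Real.log_pos (by linarith)
  calc 1 / (4 * Real.log (4 * X)) = X * (1 / (4 * X * Real.log (4 * X))) := by field_simp
    _ ≤ (∑ p ∈ Ioc ⌊X⌋₊ ⌊4 * X⌋₊ with p.Prime, Real.log p) * (1 / (4 * X * Real.log (4 * X))) := by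
        gcongr
    _ = ∑ p ∈ Ioc ⌊X⌋₊ ⌊4 * X⌋₊ with p.Prime, Real.log p * (1 / (4 * X * Real.log (4 * X))) := by
        rw [sum_mul]
    _ ≤ _ := by
        refine sum_le_sum fun p hp => ?_
        rw [mem_filter, mem_Ioc] at hp
        have hp0 : (0 : ℝ) < p := by exact_mod_cast hp.2.pos
        have hple : (p : ℝ) ≤ 4 * X := (Nat.le_floor_iff (by linarith)).1 hp.1.2
        have hlp : Real.log p ≤ Real.log (4 * X) := Real.log_le_log hp0 hple
        rw [mul_one_div, div_le_div_iff₀ (by positivity) hp0, one_mul, mul_comm]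
        gcongr

open Finset in
lemma prime_blocks : ∃ X₀ : ℝ, 1 ≤ X₀ ∧ ∀ Z Z' l : ℝ, X₀ ≤ Z → ∀ J : ℕ, 4 ^ J * Z ≤ Z' →
    Real.log Z' ≤ l → 
    J / (4 * l) ≤ ∑ p ∈ Ioc ⌊Z⌋₊ ⌊Z'⌋₊ with p.Prime, (1 : ℝ) / p := by
  obtain ⟨X₀, h0, hX⟩ := prime_block
  refine ⟨X₀, h0, fun Z Z' l hZ J => ?_⟩
  induction J generalizing Z' with
  | zero => intro _ _; simp; exact sum_nonneg fun _ _ => by positivity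
  | succ J ih =>
    intro hJ hl
    have hZ1 : 1 ≤ Z := h0.trans hZ
    have hp : (1 : ℝ) ≤ 4 ^ J := one_le_pow₀ (by norm_num)
    have hY : Z ≤ 4 ^ J * Z := by nlinarith
    have e : (4 : ℝ) ^ (J + 1) * Z = 4 * (4 ^ J * Z) := by ring
    rw [e] at hJ
    have hlog1 : Real.log (4 ^ J * Z) ≤ l :=
      (Real.log_le_log (by linarith) (by linarith)).trans hl
    have hlog2 : Real.log (4 * (4 ^ J * Z)) ≤ l :=
      (Real.log_le_log (by linarith) (by linarith)).trans hl
    have hlogp : 0 < Real.log (4 * (4 ^ J * Z)) := Real.log_pos (by linarith)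
    have a1 := ih (4 ^ J * Z) le_rfl hlog1
    have a2 := hX (4 ^ J * Z) (hZ.trans hY)
    have a3 : 1 / (4 * l) ≤ 1 / (4 * Real.log (4 * (4 ^ J * Z))) := by gcongr
    have f1 : ⌊Z⌋₊ ≤ ⌊4 ^ J * Z⌋₊ := Nat.floor_mono hY
    have f2 : ⌊4 ^ J * Z⌋₊ ≤ ⌊4 * (4 ^ J * Z)⌋₊ := Nat.floor_mono (by linarith)
    have f3 : ⌊4 * (4 ^ J * Z)⌋₊ ≤ ⌊Z'⌋₊ := Nat.floor_mono hJ
    have a4 : ∑ p ∈ Ioc ⌊Z⌋₊ ⌊4 * (4 ^ J * Z)⌋₊ with p.Prime, (1 : ℝ) / p =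
      ∑ p ∈ Ioc ⌊Z⌋₊ ⌊4 ^ J * Z⌋₊ with p.Prime, (1 : ℝ) / p +
      ∑ p ∈ Ioc ⌊4 ^ J * Z⌋₊ ⌊4 * (4 ^ J * Z)⌋₊ with p.Prime, (1 : ℝ) / p := by
      rw [sum_filter, sum_filter, sum_filter]
      exact (sum_Ioc_consecutive _ f1 f2).symm
    have a5 : ∑ p ∈ Ioc ⌊Z⌋₊ ⌊4 * (4 ^ J * Z)⌋₊ with p.Prime, (1 : ℝ) / p ≤
        ∑ p ∈ Ioc ⌊Z⌋₊ ⌊Z'⌋₊ with p.Prime, (1 : ℝ) / p :=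
      sum_le_sum_of_subset_of_nonneg
        (filter_subset_filter _ (Ioc_subset_Ioc_right f3)) fun _ _ _ => by positivity
    push_cast
    rw [add_div]
    linarith

open Finset in
lemma sieve_bound' (m a N D : ℕ) (hm : 0 < m) (hD : 2 ≤ D) (T : Finset ℕ)
    (hT : ∀ n ∈ T, n < N ∧ n ≡ a [MOD m] ∧ ∀ p, p.Prime → p ≤ D → ¬ p ∣ n) :
    (#T : ℝ) ≤ (N : ℝ) / (m.totient * Real.log D) + (D : ℝ) ^ 4 := by
  refine (sieve_bound m a N D hm (by omega) T hT).trans ?_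
  have hV := V_lower m D hm
  set V := ∑ k ∈ Icc 1 D with Squarefree k ∧ k.Coprime m, 1 / (k.totient : ℝ)
  have hφ : (0 : ℝ) < m.totient := by exact_mod_cast Nat.totient_pos.2 hm
  have hmR : (0 : ℝ) < m := by exact_mod_cast hm
  have hl : 0 < Real.log D := Real.log_pos (by exact_mod_cast hD)
  rw [div_mul_eq_mul_div, le_div_iff₀ hφ] at hV
  rw [div_div]
  gcongr ?_ + _
  apply div_le_div_of_nonneg_left (by positivity) (by positivity)
  linarith

set_option maxHeartbeats 2000000 in
open Finset in
/-- Bookkeeping hypotheses satisfied for all large `m`. -/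
lemma density_core (η : ℝ) (hη : 0 < η) (hη1 : η ≤ 1) (m : ℕ) (s t L X₀ : ℝ)
    (hX₀ : ∀ Z Z' l : ℝ, X₀ ≤ Z → ∀ J : ℕ, 4 ^ J * Z ≤ Z' →
      Real.log Z' ≤ l → J / (4 * l) ≤ ∑ p ∈ Ioc ⌊Z⌋₊ ⌊Z'⌋₊ with p.Prime, (1 : ℝ) / p)
    (hm : 0 < m) (hs : s ^ 2 = m) (hs1 : 1 ≤ s) (hsX : X₀ ≤ s) (hsη : 1000 ≤ η * s)
    (hL : L = Real.log m) (hlt : Real.log t = η / 8 * L) (ht : 1000 ≤ t) (htL : 1000 * L ≤ t)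
    (hω : (#m.primeFactors : ℝ) ≤ t) (hL1 : 1 ≤ L) :
    ∃ W : Finset (ZMod m)ˣ, η ^ 2 / 33792 * m.totient ≤ #W ∧ ∀ w ∈ W, ∃ p q : ℕ,
      p.Prime ∧ q.Prime ∧ (p : ℝ) ≤ s * t ^ 8 ∧ (q : ℝ) ≤ s * t ^ 8 ∧
      ((p : ZMod m) * (q : ZMod m)) = (w : ZMod m) := by
  have hmR : (0 : ℝ) < m := by exact_mod_cast hm
  have hφ : (0 : ℝ) < m.totient := by exact_mod_cast Nat.totient_pos.2 hm
  have hφm : (m.totient : ℝ) ≤ m := by exact_mod_cast Nat.totient_le m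
  have ht0 : 0 < t := by linarith
  have hs0 : 0 < s := by linarith
  set y : ℝ := s ^ 2 * t ^ 8 with hy
  have hlogs : Real.log s = L / 2 := by
    have : Real.log (s ^ 2) = L := by rw [hs, hL]
    rw [Real.log_pow] at this; push_cast at this; linarith
  have hlogy : Real.log y ≤ 2 * L := by
    rw [hy, Real.log_mul (by positivity) (by positivity), Real.log_pow, Real.log_pow, hlogs, hlt]
    push_cast; nlinarith
  -- first prime
  set Q1 := {p ∈ Ioc ⌊s * t⌋₊ ⌊s * t ^ 2⌋₊ | p.Prime ∧ ¬ p ∣ m} with hQ1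
  have hsum1 : η / 128 ≤ ∑ p ∈ Q1, (1 : ℝ) / p := by
    have hl4 : Real.log 4 ≤ 1.39 := by
      have : Real.log 4 = 2 * Real.log 2 := by
        rw [← Real.log_rpow (by norm_num)]; norm_num
      rw [this]; linarith [Real.log_two_lt_d9]
    have hl4p : 0 < Real.log 4 := Real.log_pos (by norm_num)
    have hlt4 : 2 * Real.log 4 ≤ Real.log t := by
      have : 2 * Real.log 4 = Real.log (4 ^ 2) := by rw [Real.log_pow]; norm_num
      rw [this]; apply Real.log_le_log (by norm_num); linarith
    set J := ⌊Real.log t / Real.log 4⌋₊ with hJ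
    have hJ1 : (J : ℝ) ≤ Real.log t / Real.log 4 := Nat.floor_le (div_nonneg (by linarith) hl4p.le)
    have hJ2 : Real.log t / Real.log 4 < J + 1 := Nat.lt_floor_add_one _
    have h4J : (4 : ℝ) ^ J ≤ t := by
      rw [le_div_iff₀ hl4p] at hJ1
      rw [← Real.log_le_log_iff (by positivity) ht0, Real.log_pow]
      exact hJ1
    have hJ3 : η * L / 24 ≤ J := by
      have h1 : 2 ≤ Real.log t / Real.log 4 := by rw [le_div_iff₀ hl4p]; exact hlt4
      have h2 : Real.log t / 1.39 ≤ Real.log t / Real.log 4 := by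
        apply div_le_div_of_nonneg_left _ hl4p hl4; linarith
      rw [hlt] at h2 h1 hJ2
      have h3 : 0 < η * L := by positivity
      have h4 : η / 8 * L / 1.39 = (η * L) / 11.12 := by norm_num; ring
      rw [h4] at h2
      have : η * L / 12 ≤ η * L / 11.12 := by gcongr; norm_num
      linarith
    have hb := hX₀ (s * t) (s * t ^ 2) L (by nlinarith) J (by
      calc (4 : ℝ) ^ J * (s * t) ≤ t * (s * t) := by gcongr
        _ = _ := by ring) (by
      rw [Real.log_mul (by positivity) (by positivity), Real.log_pow, hlogs, hlt]
      push_cast; nlinarith)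
    have hb2 : η / 96 ≤ ∑ p ∈ Ioc ⌊s * t⌋₊ ⌊s * t ^ 2⌋₊ with p.Prime, (1 : ℝ) / p := by
      refine le_trans ?_ hb
      rw [le_div_iff₀ (by positivity)]
      linarith
    have hsplit : ∑ p ∈ Ioc ⌊s * t⌋₊ ⌊s * t ^ 2⌋₊ with p.Prime, (1 : ℝ) / p ≤
        ∑ p ∈ Q1, (1 : ℝ) / p + ∑ p ∈ m.primeFactors with ⌊s * t⌋₊ < p, (1 : ℝ) / p := by
      calc _ ≤ ∑ p ∈ Q1 ∪ {p ∈ m.primeFactors | ⌊s * t⌋₊ < p}, (1 : ℝ) / p := by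
            refine sum_le_sum_of_subset_of_nonneg ?_ fun _ _ _ => by positivity
            intro p hp
            rw [mem_filter] at hp
            rw [mem_union, hQ1, mem_filter, mem_filter, Nat.mem_primeFactors]
            by_cases h : p ∣ m
            · exact Or.inr ⟨⟨hp.2, h, hm.ne'⟩, (mem_Ioc.1 hp.1).1⟩
            · exact Or.inl ⟨hp.1, hp.2, h⟩
        _ ≤ _ := by
            rw [← sum_union_inter]
            have : 0 ≤ ∑ p ∈ Q1 ∩ {p ∈ m.primeFactors | ⌊s * t⌋₊ < p}, (1 : ℝ) / p :=
              sum_nonneg fun _ _ => by positivity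
            linarith
    have hbad : ∑ p ∈ m.primeFactors with ⌊s * t⌋₊ < p, (1 : ℝ) / p ≤ 1 / s := by
      calc _ ≤ ∑ p ∈ m.primeFactors with ⌊s * t⌋₊ < p, 1 / (s * t) := by
            refine sum_le_sum fun p hp => ?_
            have := (Nat.floor_lt (by positivity)).1 (mem_filter.1 hp).2
            gcongr
        _ = #{p ∈ m.primeFactors | ⌊s * t⌋₊ < p} * (1 / (s * t)) := by simp
        _ ≤ t * (1 / (s * t)) := by
            gcongr
            refine le_trans ?_ hω
            exact_mod_cast card_filter_le _ _
        _ = 1 / s := by field_simp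
    have : 1 / s ≤ η / 1000 := by
      rw [div_le_div_iff₀ hs0 (by norm_num)]; linarith
    linarith
  -- second prime
  set Q2 : ℕ → Finset ℕ := fun p => {q ∈ Ioc ⌊s * t ^ 2⌋₊ ⌊y / p⌋₊ | q.Prime ∧ ¬ q ∣ m} with hQ2
  have hcard2 : ∀ p ∈ Q1, y / (8 * L) * (1 / (p : ℝ)) ≤ #(Q2 p) := by
    intro p hp
    rw [hQ1, mem_filter, mem_Ioc] at hp
    have hp0 : (0 : ℝ) < p := by exact_mod_cast hp.2.1.pos
    have hp1 : (1 : ℝ) ≤ p := by exact_mod_cast hp.2.1.pos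
    have hple : (p : ℝ) ≤ s * t ^ 2 := (Nat.le_floor_iff (by positivity)).1 hp.1.2
    have hyp : s * t ^ 6 ≤ y / p := by
      rw [le_div_iff₀ hp0]
      calc s * t ^ 6 * p ≤ s * t ^ 6 * (s * t ^ 2) := by gcongr
        _ = y := by rw [hy]; ring
    have ht6 : t ≤ t ^ 6 := le_self_pow₀ (by linarith) (by norm_num)
    have hy100 : 100 ≤ y / p := by nlinarith
    have hpi := cheb_lower hy100
    have hlog : Real.log (y / p) ≤ 2 * L := by
      refine le_trans (Real.log_le_log (by linarith) ?_) hlogy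
      exact div_le_self (by positivity) hp1
    have hlogp : 0 < Real.log (y / p) := Real.log_pos (by linarith)
    have h1 : y / p / (4 * L) ≤ y / p / (2 * Real.log (y / p)) := by
      apply div_le_div_of_nonneg_left (by positivity) (by positivity); linarith
    have h2 : (Nat.primeCounting ⌊y / p⌋₊ : ℝ) ≤ #(Q2 p) + s * t ^ 2 + t := by
      have e1 : Nat.primeCounting ⌊y / p⌋₊ = #{q ∈ range (⌊y / p⌋₊ + 1) | q.Prime} := by
        rw [Nat.primeCounting, Nat.primeCounting', Nat.count_eq_card_filter_range]
      have e2 : {q ∈ range (⌊y / p⌋₊ + 1) | q.Prime} ⊆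
          (Q2 p ∪ Ioc 0 ⌊s * t ^ 2⌋₊) ∪ m.primeFactors := by
        intro q hq
        rw [mem_filter, mem_range] at hq
        rw [mem_union, mem_union, hQ2, mem_filter, mem_Ioc, mem_Ioc, Nat.mem_primeFactors]
        by_cases h : q ∣ m
        · exact Or.inr ⟨hq.2, h, hm.ne'⟩
        · left
          have := hq.2.pos
          rcases lt_or_ge ⌊s * t ^ 2⌋₊ q with h3 | h3
          · exact Or.inl ⟨⟨h3, by omega⟩, hq.2, h⟩
          · exact Or.inr ⟨this, h3⟩
      have e3 := (card_le_card e2).trans ((card_union_le _ _).trans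
        (Nat.add_le_add_right (card_union_le _ _) _))
      rw [← e1, Nat.card_Ioc, Nat.sub_zero] at e3
      have e4 : (Nat.primeCounting ⌊y / p⌋₊ : ℝ) ≤ #(Q2 p) + ⌊s * t ^ 2⌋₊ + #m.primeFactors := by
        exact_mod_cast e3
      have e5 : (⌊s * t ^ 2⌋₊ : ℝ) ≤ s * t ^ 2 := Nat.floor_le (by positivity)
      linarith
    have h3 : s * t ^ 2 + t ≤ y / p / (8 * L) := by
      rw [le_div_iff₀ (by positivity)]
      refine le_trans ?_ hyp
      have a1 : t ≤ s * t ^ 2 := by nlinarith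
      calc (s * t ^ 2 + t) * (8 * L) ≤ (s * t ^ 2 + s * t ^ 2) * (8 * t) := by gcongr; linarith
        _ = s * t ^ 3 * 16 := by ring
        _ ≤ s * t ^ 3 * t ^ 3 := by
            gcongr
            have : t ≤ t ^ 3 := le_self_pow₀ (by linarith) (by norm_num)
            linarith
        _ = _ := by ring
    have h4 : y / p / (4 * L) = 2 * (y / p / (8 * L)) := by field_simp; ring
    have h5 : y / (8 * L) * (1 / (p : ℝ)) = y / p / (8 * L) := by field_simp
    rw [h5]; linarith
  -- pairs
  set Q := Q1.sigma Q2 with hQ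
  have hQcard : η * y / (1024 * L) ≤ #Q := by
    rw [hQ, card_sigma]
    push_cast
    calc η * y / (1024 * L) = y / (8 * L) * (η / 128) := by field_simp; ring
      _ ≤ y / (8 * L) * ∑ p ∈ Q1, (1 : ℝ) / p := by gcongr
      _ = ∑ p ∈ Q1, y / (8 * L) * ((1 : ℝ) / p) := by rw [mul_sum]
      _ ≤ _ := sum_le_sum hcard2
  have hQmem : ∀ x ∈ Q, x.1.Prime ∧ x.2.Prime ∧ ¬ x.1 ∣ m ∧ ¬ x.2 ∣ m ∧ s * t < x.1 ∧
      (x.1 : ℝ) ≤ s * t ^ 2 ∧ s * t ^ 2 < x.2 ∧ (x.1 : ℝ) * x.2 ≤ y := by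
    rintro ⟨p, q⟩ h
    rw [hQ, mem_sigma] at h
    simp only [hQ1, hQ2, mem_filter, mem_Ioc] at h
    obtain ⟨⟨⟨h1, h2⟩, h3, h4⟩, ⟨h5, h6⟩, h7, h8⟩ := h
    have hp0 : (0 : ℝ) < p := by exact_mod_cast h3.pos
    refine ⟨h3, h7, h4, h8, (Nat.floor_lt (by positivity)).1 h1,
      (Nat.le_floor_iff (by positivity)).1 h2, (Nat.floor_lt (by positivity)).1 h5, ?_⟩
    have := (Nat.le_floor_iff (by positivity)).1 h6
    rw [le_div_iff₀ hp0] at this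
    linarith
  have hQsize : ∀ x ∈ Q, (x.1 : ℝ) ≤ s * t ^ 8 ∧ (x.2 : ℝ) ≤ s * t ^ 8 := by
    intro x hx
    obtain ⟨h3, h7, h4, h8, h9, h10, h11, h12⟩ := hQmem x hx
    constructor
    · refine h10.trans ?_
      have : t ^ 2 ≤ t ^ 8 := pow_le_pow_right₀ (by linarith) (by norm_num)
      gcongr
    · have h13 : s * t * x.2 ≤ s * t * (s * t ^ 7) := by
        calc s * t * x.2 ≤ x.1 * x.2 := by gcongr
          _ ≤ y := h12
          _ = _ := by rw [hy]; ring
      have h14 : (x.2 : ℝ) ≤ s * t ^ 7 := le_of_mul_le_mul_left h13 (by positivity)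
      have : t ^ 7 ≤ t ^ 8 := pow_le_pow_right₀ (by linarith) (by norm_num)
      exact h14.trans (by gcongr)
  have hcop : ∀ x ∈ Q, (x.1 * x.2).Coprime m := by
    intro x hx
    obtain ⟨h3, h7, h4, h8, _⟩ := hQmem x hx
    exact Nat.Coprime.mul_left (h3.coprime_iff_not_dvd.2 h4) (h7.coprime_iff_not_dvd.2 h8)
  set F : (_ : ℕ) × ℕ → (ZMod m)ˣ := fun x =>
    if h : (x.1 * x.2).Coprime m then ZMod.unitOfCoprime (x.1 * x.2) h else 1 with hF
  have hFval : ∀ x ∈ Q, (F x : ZMod m) = ((x.1 * x.2 : ℕ) : ZMod m) := by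
    intro x hx
    simp only [hF, dif_pos (hcop x hx), ZMod.coe_unitOfCoprime]
  classical
  refine ⟨Q.image F, ?_, ?_⟩
  swap
  · intro w hw
    obtain ⟨x, hx, rfl⟩ := mem_image.1 hw
    obtain ⟨h3, h7, _⟩ := hQmem x hx
    refine ⟨x.1, x.2, h3, h7, (hQsize x hx).1, (hQsize x hx).2, ?_⟩
    rw [hFval x hx]; push_cast; rfl
  -- fibres
  have hfib : ∀ w ∈ Q.image F, (#{x ∈ Q | F x = w} : ℝ) ≤ 33 * y / (η * m.totient * L) := by
    intro w hw
    obtain ⟨x0, hx0, rfl⟩ := mem_image.1 hw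
    set T := image (fun x : (_ : ℕ) × ℕ => x.1 * x.2) {x ∈ Q | F x = F x0} with hT
    have hTcard : #{x ∈ Q | F x = F x0} = #T := by
      symm
      refine card_image_of_injOn ?_
      intro a ha b hb hab
      simp only [coe_filter, Set.mem_ofPred_eq] at ha hb
      obtain ⟨a3, a7, a4, a8, a9, a10, a11, a12⟩ := hQmem a ha.1
      obtain ⟨b3, b7, b4, b8, b9, b10, b11, b12⟩ := hQmem b hb.1
      have hab' : a.1 * a.2 = b.1 * b.2 := hab
      have hd : a.1 ∣ b.1 * b.2 := hab' ▸ dvd_mul_right _ _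
      have h1 : a.1 = b.1 := by
        rcases (Nat.Prime.dvd_mul a3).1 hd with h | h
        · exact (Nat.prime_dvd_prime_iff_eq a3 b3).1 h
        · have := (Nat.prime_dvd_prime_iff_eq a3 b7).1 h
          rw [this] at a10
          linarith
      have h2 : a.2 = b.2 := by
        rw [h1] at hab'
        exact Nat.eq_of_mul_eq_mul_left b3.pos hab'
      obtain ⟨a1, a2⟩ := a
      obtain ⟨b1, b2⟩ := b
      simp only at h1 h2
      subst h1; subst h2; rfl
    have hD2 : 2 ≤ ⌊t⌋₊ := Nat.le_floor (by push_cast; linarith)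
    have hsv := sieve_bound' m (x0.1 * x0.2) (⌊y⌋₊ + 1) ⌊t⌋₊ hm hD2 T (by
      intro n hn
      obtain ⟨x, hx, rfl⟩ := mem_image.1 hn
      rw [mem_filter] at hx
      obtain ⟨h3, h7, h4, h8, h9, h10, h11, h12⟩ := hQmem x hx.1
      refine ⟨?_, ?_, ?_⟩
      · apply Nat.lt_succ_of_le
        apply Nat.le_floor
        push_cast; exact h12
      · rw [← ZMod.natCast_eq_natCast_iff, ← hFval x hx.1, ← hFval x0 hx0, hx.2]
      · intro p hp hpt hdvd
        have hpt' : (p : ℝ) ≤ t := (Nat.le_floor_iff (by positivity)).1 hpt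
        have b0 : t ≤ s * t := le_mul_of_one_le_left ht0.le hs1
        have b0' : s * t ≤ s * t ^ 2 := by
          gcongr
          exact le_self_pow₀ (by linarith) (by norm_num)
        have b1 : t < x.1 := by linarith
        have b2 : t < x.2 := by linarith
        rcases (Nat.Prime.dvd_mul hp).1 hdvd with h | h
        · rw [(Nat.prime_dvd_prime_iff_eq hp h3).1 h] at hpt'; linarith
        · rw [(Nat.prime_dvd_prime_iff_eq hp h7).1 h] at hpt'; linarith)
    rw [hTcard]
    refine hsv.trans ?_
    have hy1 : 1 ≤ y := by
      rw [hy]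
      have := one_le_pow₀ (n := 2) hs1
      have := one_le_pow₀ (n := 8) (a := t) (by linarith)
      nlinarith
    have hN : ((⌊y⌋₊ + 1 : ℕ) : ℝ) ≤ 2 * y := by
      push_cast
      have := Nat.floor_le (a := y) (by linarith)
      linarith
    have hfl : t / 2 ≤ (⌊t⌋₊ : ℝ) := by
      have := Nat.lt_floor_add_one t
      linarith
    have hflt : (⌊t⌋₊ : ℝ) ≤ t := Nat.floor_le (by linarith)
    have hlogD : η * L / 16 ≤ Real.log ⌊t⌋₊ := by
      have h1 : Real.log (t / 2) ≤ Real.log ⌊t⌋₊ := Real.log_le_log (by positivity) hfl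
      rw [Real.log_div (by positivity) (by norm_num), hlt] at h1
      have h2 : 2 * Real.log 2 ≤ Real.log t := by
        have : 2 * Real.log 2 = Real.log (2 ^ 2) := by rw [Real.log_pow]; norm_num
        rw [this]; apply Real.log_le_log (by norm_num); linarith
      rw [hlt] at h2
      linarith
    have p1 : ((⌊y⌋₊ + 1 : ℕ) : ℝ) / (m.totient * Real.log ⌊t⌋₊) ≤
        2 * y / (m.totient * (η * L / 16)) := by gcongr
    have p2 : (⌊t⌋₊ : ℝ) ^ 4 ≤ y / (η * m.totient * L) := by
      rw [le_div_iff₀ (by positivity)]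
      calc (⌊t⌋₊ : ℝ) ^ 4 * (η * m.totient * L) ≤ t ^ 4 * (1 * m * t) := by
            gcongr; linarith
        _ = m * t ^ 5 := by ring
        _ ≤ m * t ^ 8 := by gcongr <;> first | linarith | norm_num
        _ = y := by rw [hy, hs]
    have p3 : 2 * y / (m.totient * (η * L / 16)) = 32 * y / (η * m.totient * L) := by
      field_simp; ring
    calc _ ≤ 32 * y / (η * m.totient * L) + y / (η * m.totient * L) := by linarith
      _ = _ := by ring
  have hall : (#Q : ℝ) ≤ #(Q.image F) * (33 * y / (η * m.totient * L)) := by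
    rw [card_eq_sum_card_image F Q]
    push_cast
    refine (sum_le_sum hfib).trans ?_
    simp
  have hy0 : 0 < y := by positivity
  have hfin := hQcard.trans hall
  rw [mul_div_assoc', div_le_div_iff₀ (by positivity) (by positivity)] at hfin
  have hyL : 0 < y * L := by positivity
  have : (η ^ 2 / 33792 * m.totient) * (33792 * (y * L)) ≤ #(Q.image F) * (33792 * (y * L)) := by
    calc _ = η * y * (η * m.totient * L) := by ring
      _ ≤ _ := hfin
      _ = _ := by ring
  exact le_of_mul_le_mul_right this (by positivity)

open Finset Filter in
lemma density (η : ℝ) (hη : 0 < η) (hη1 : η ≤ 1) : ∀ᶠ m : ℕ in atTop,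
    ∃ W : Finset (ZMod m)ˣ, η ^ 2 / 33792 * m.totient ≤ #W ∧ ∀ w ∈ W, ∃ p q : ℕ,
      p.Prime ∧ q.Prime ∧ (p : ℝ) ≤ (m : ℝ) ^ (1 / 2 + η) ∧ (q : ℝ) ≤ (m : ℝ) ^ (1 / 2 + η) ∧
      ((p : ZMod m) * (q : ZMod m)) = (w : ZMod m) := by
  obtain ⟨X₀, _, hX₀⟩ := prime_blocks
  obtain ⟨C, hC, hW⟩ := two_pow_omega_le (η / 16) (by positivity)
  have hcast := tendsto_natCast_atTop_atTop (R := ℝ)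
  have e1 : ∀ᶠ m : ℕ in atTop, (1000 : ℝ) ≤ (m : ℝ) ^ (η / 8) :=
    ((tendsto_rpow_atTop (by positivity)).comp hcast).eventually_ge_atTop 1000
  have e2 : ∀ᶠ m : ℕ in atTop, C ≤ (m : ℝ) ^ (η / 16) :=
    ((tendsto_rpow_atTop (by positivity)).comp hcast).eventually_ge_atTop C
  have e3 : ∀ᶠ m : ℕ in atTop, Real.log m ≤ (1 / 1000) * (m : ℝ) ^ (η / 8) := by
    have := (isLittleO_log_rpow_atTop (r := η / 8) (by positivity)).bound
      (c := 1 / 1000) (by positivity)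
    filter_upwards [hcast.eventually this] with m hm
    have h := (le_abs_self _).trans hm
    rwa [Real.norm_of_nonneg (by positivity)] at h
  have e4 : ∀ᶠ m : ℕ in atTop, max (max 1 X₀) (1000 / η) ≤ √(m : ℝ) :=
    (Real.tendsto_sqrt_atTop.comp hcast).eventually_ge_atTop _
  have e5 : ∀ᶠ m : ℕ in atTop, 1 ≤ Real.log (m : ℝ) :=
    (Real.tendsto_log_atTop.comp hcast).eventually_ge_atTop _
  filter_upwards [e1, e2, e3, e4, e5, eventually_ge_atTop 1] with m h1 h2 h3 h4 h5 hm
  have hm0 : (0 : ℝ) < m := by exact_mod_cast hm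
  have hX : (m : ℝ) ^ (1 / 2 + η) = √(m : ℝ) * ((m : ℝ) ^ (η / 8)) ^ 8 := by
    rw [Real.sqrt_eq_rpow, ← Real.rpow_natCast, ← Real.rpow_mul hm0.le,
      ← Real.rpow_add hm0]
    congr 1; push_cast; ring
  have hWt : (2 : ℝ) ^ #m.primeFactors ≤ (m : ℝ) ^ (η / 8) := by
    refine (hW m hm).trans ?_
    calc C * (m : ℝ) ^ (η / 16) ≤ (m : ℝ) ^ (η / 16) * (m : ℝ) ^ (η / 16) := by gcongr
      _ = (m : ℝ) ^ (η / 8) := by rw [← Real.rpow_add hm0]; congr 1; ring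
  simp only [max_le_iff] at h4
  rw [hX]
  refine density_core η hη hη1 m _ _ (Real.log m) X₀ hX₀ hm (Real.sq_sqrt hm0.le) h4.1.1 h4.1.2
    ?_ rfl (Real.log_rpow hm0 _) h1 (by linarith) ?_ h5
  · have := h4.2
    rw [div_le_iff₀ hη] at this
    linarith
  · refine le_trans ?_ hWt
    exact_mod_cast (Nat.lt_two_pow_self).le

open Finset Pointwise in
lemma list_of_pow {m : ℕ} [NeZero m] (x : ℝ) (B : Finset (ZMod m)ˣ)
    (hB : ∀ b ∈ B, ∃ l : List ℕ, l.length ≤ 2 ∧ (∀ q ∈ l, q.Prime ∧ (q : ℝ) ≤ x) ∧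
      ((l.prod : ℕ) : ZMod m) = b) (n : ℕ) :
    ∀ u ∈ B ^ n, ∃ l : List ℕ, l.length ≤ 2 * n ∧ (∀ q ∈ l, q.Prime ∧ (q : ℝ) ≤ x) ∧
      ((l.prod : ℕ) : ZMod m) = u := by
  induction n with
  | zero =>
    intro u hu
    rw [pow_zero, mem_one] at hu
    subst hu
    exact ⟨[], by simp, by simp, by simp⟩
  | succ n ih =>
    intro u hu
    rw [pow_succ, mem_mul] at hu
    obtain ⟨v, hv, b, hb, rfl⟩ := hu
    obtain ⟨l, h1, h2, h3⟩ := ih v hv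
    obtain ⟨l', h1', h2', h3'⟩ := hB b hb
    refine ⟨l ++ l', by rw [List.length_append]; omega, ?_, ?_⟩
    · intro q hq
      rcases List.mem_append.1 hq with h | h
      · exact h2 q h
      · exact h2' q h
    · rw [List.prod_append, Nat.cast_mul, h3, h3', Units.val_mul]

open Finset Filter Pointwise in
theorem main_aux (η : ℝ) (hη : 0 < η) (hη1 : η ≤ 1) : ∃ k : ℕ, 0 < k ∧ ∀ᶠ m : ℕ in atTop,
    ∀ u : (ZMod m)ˣ, ∃ l : List ℕ, l.length ≤ k ∧
      (∀ q ∈ l, q.Prime ∧ (q : ℝ) ≤ (m : ℝ) ^ (1 / 2 + η)) ∧ ((l.prod : ℕ) : ZMod m) = u := by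
  obtain ⟨i, hi⟩ := pow_unbounded_of_one_lt (33792 / η ^ 2) (show (1 : ℝ) < 3 / 2 by norm_num)
  refine ⟨2 * 2 ^ i, by positivity, ?_⟩
  filter_upwards [density η hη hη1, gen_primes η hη, eventually_ge_atTop 1] with m hd hg hm
  have : NeZero m := ⟨by omega⟩
  classical
  obtain ⟨W, hW1, hW2⟩ := hd
  set x := (m : ℝ) ^ (1 / 2 + η) with hx
  set B : Finset (ZMod m)ˣ := {b | ∃ l : List ℕ, l.length ≤ 2 ∧ (∀ q ∈ l, q.Prime ∧ (q : ℝ) ≤ x) ∧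
      ((l.prod : ℕ) : ZMod m) = b} with hB
  have memB : ∀ b, b ∈ B ↔ ∃ l : List ℕ, l.length ≤ 2 ∧ (∀ q ∈ l, q.Prime ∧ (q : ℝ) ≤ x) ∧
      ((l.prod : ℕ) : ZMod m) = b := by intro b; simp [hB]
  have h1 : 1 ∈ B := (memB 1).2 ⟨[], by simp, by simp, by simp⟩
  have hgen : Subgroup.closure (B : Set (ZMod m)ˣ) = ⊤ := by
    rw [eq_top_iff, ← hg]
    apply Subgroup.closure_mono
    rintro u ⟨p, hp, hpx, hpu⟩
    rw [mem_coe, memB]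
    exact ⟨[p], by simp, by simp [hp, hpx], by simpa using hpu⟩
  have hWB : W ⊆ B := by
    intro w hw
    obtain ⟨p, q, hp, hq, hpx, hqx, h⟩ := hW2 w hw
    rw [memB]
    exact ⟨[p, q], by simp, by simp [hp, hq, hpx, hqx], by simpa using h⟩
  have hcard : (Fintype.card (ZMod m)ˣ : ℚ) < (3 / 2 : ℚ) ^ i * #B := by
    rw [ZMod.card_units_eq_totient]
    have hφ : (0 : ℝ) < m.totient := by exact_mod_cast Nat.totient_pos.2 hm
    have h2 : (#W : ℝ) ≤ #B := by exact_mod_cast card_le_card hWB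
    have h3 : (m.totient : ℝ) < (3 / 2 : ℝ) ^ i * #B := by
      calc (m.totient : ℝ) = 33792 / η ^ 2 * (η ^ 2 / 33792 * m.totient) := by field_simp
        _ < (3 / 2 : ℝ) ^ i * (η ^ 2 / 33792 * m.totient) := by gcongr
        _ ≤ _ := by gcongr; linarith
    have h4 : (((m.totient : ℚ)) : ℝ) < (((3 / 2 : ℚ) ^ i * #B : ℚ) : ℝ) := by
      push_cast; exact h3
    exact Rat.cast_lt.1 h4
  have hgr := growth B h1 hgen i hcard
  intro u
  exact list_of_pow x B (fun b hb => (memB b).1 hb) (2 ^ i) u (by rw [hgr]; exact mem_univ u)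

theorem stmt_19 :
    ∀ η : ℝ, 0 < η → ∃ k : ℕ, 0 < k ∧
      ∀ ε : ℝ, 0 < ε → ∃ M : ℕ, ∀ m : ℕ, M ≤ m → ∀ a : ℤ, Int.gcd a m = 1 →
        ∃ L : List ℕ, L.length ≤ k ∧
          (∀ q ∈ L, q.Prime ∧ (q : ℝ) ≤ (m : ℝ) ^ (1 / 2 + η + ε)) ∧
          ((L.prod : ℕ) : ℤ) ≡ a [ZMOD (m : ℤ)] := by
  intro η hη
  obtain ⟨k, hk, hev⟩ := main_aux (min η 1) (lt_min hη one_pos) (min_le_right _ _)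
  refine ⟨k, hk, fun ε hε => ?_⟩
  obtain ⟨M, hM⟩ := Filter.eventually_atTop.1 hev
  refine ⟨max M 1, fun m hm a ha => ?_⟩
  have hm1 : 1 ≤ m := (le_max_right _ _).trans hm
  have hu : IsUnit ((a : ℤ) : ZMod m) := by
    rw [ZMod.coe_int_isUnit_iff_isCoprime, isCoprime_comm, Int.isCoprime_iff_gcd_eq_one]
    exact ha
  obtain ⟨u, hu⟩ := hu
  obtain ⟨l, h1, h2, h3⟩ := hM m ((le_max_left _ _).trans hm) u
  refine ⟨l, h1, fun q hq => ⟨(h2 q hq).1, (h2 q hq).2.trans ?_⟩, ?_⟩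
  · apply Real.rpow_le_rpow_of_exponent_le (by exact_mod_cast hm1)
    linarith [min_le_left η 1]
  · rw [← ZMod.intCast_eq_intCast_iff, ← hu, ← h3, Int.cast_natCast]
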